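/- Let d = 3. There exists a constant C such that for all λ ∈ ℂ and all ψ ∈ ℓ^{14/13}(ℤ³), ‖ψ‖_{ℓ^{14}(ℤ³)} ≤ C ‖(√(1−Δ) − λ)ψ‖_{ℓ^{14/13}(ℤ³)}. (Here 14 = 2σ/(σ−1) and 14/13 = 2σ/(σ+1) with σ = 7/6.) -/

import Mathlib

open MeasureTheory Real
open scoped ENNReal

noncomputable section

/-- Dispersion relation of the discrete Klein--Gordon equation on `ℤ^d`. -/
def omegaKG (d : ℕ) (ξ : Fin d → ℝ) : ℝ :=
  Real.sqrt (1 + ∑ j : Fin d, 2 * (1 - Real.cos (ξ j)))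

/-- The fundamental domain `[0, 2π]^d` of the torus. -/
def cube (d : ℕ) : Set (Fin d → ℝ) := Set.Icc 0 (fun _ => 2 * Real.pi)

/-- The convolution kernel of the Fourier multiplier on `ℤ^d` with symbol `m(ξ)`. -/
def multKernel (d : ℕ) (m : (Fin d → ℝ) → ℝ) (x : Fin d → ℤ) : ℂ :=
  ((((2 * Real.pi) ^ d)⁻¹ : ℝ) : ℂ) *
    ∫ ξ in cube d,
      Complex.exp (Complex.I * ((∑ j : Fin d, (x j : ℝ) * ξ j : ℝ) : ℂ)) * ((m ξ : ℝ) : ℂ)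

/-- The propagator `cos(t√(1−Δ))`, realized as the Fourier multiplier with symbol
`cos(t ω(ξ))`. -/
def cosProp (d : ℕ) (t : ℝ) (f : (Fin d → ℤ) → ℂ) (x : Fin d → ℤ) : ℂ :=
  ∑' y : Fin d → ℤ, multKernel d (fun ξ => Real.cos (t * omegaKG d ξ)) (x - y) * f y

/-- The propagator `sin(t√(1−Δ))/√(1−Δ)`, realized as the Fourier multiplier with symbol
`sin(t ω(ξ))/ω(ξ)`. -/
def sinProp (d : ℕ) (t : ℝ) (f : (Fin d → ℤ) → ℂ) (x : Fin d → ℤ) : ℂ :=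
  ∑' y : Fin d → ℤ, multKernel d (fun ξ => Real.sin (t * omegaKG d ξ) / omegaKG d ξ) (x - y) * f y

/-- The operator `√(1−Δ)`, realized as the Fourier multiplier with symbol `ω(ξ)`. -/
def sqrtOneSubLap (d : ℕ) (f : (Fin d → ℤ) → ℂ) (x : Fin d → ℤ) : ℂ :=
  ∑' y : Fin d → ℤ, multKernel d (omegaKG d) (x - y) * f y

/-- The solution of the inhomogeneous discrete Klein--Gordon equation with data `(f,g)`
and forcing term `F`, given by Duhamel's formula. -/
def duhamel (d : ℕ) (t : ℝ) (f g : (Fin d → ℤ) → ℂ) (F : ℝ → (Fin d → ℤ) → ℂ)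
    (x : Fin d → ℤ) : ℂ :=
  cosProp d t f x + sinProp d t g x + ∫ s in (0:ℝ)..t, sinProp d (t - s) (F s) x

/-- The `L^q` norm in time of an `ℝ≥0∞`-valued function. -/
def lqNorm (q : ℝ≥0∞) (g : ℝ → ℝ≥0∞) : ℝ≥0∞ :=
  if q = ∞ then essSup g volume else (∫⁻ t, g t ^ q.toReal) ^ (1 / q.toReal)

/-- The mixed space-time norm `‖F‖_{L^q_t ℓ^r_x}`. -/
def mixedNorm (d : ℕ) (q r : ℝ≥0∞) (F : ℝ → (Fin d → ℤ) → ℂ) : ℝ≥0∞ :=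
  lqNorm q fun t => eLpNorm (F t) r Measure.count

/-- **Van der Corput's lemma** (first derivative test) for a convex phase. -/
theorem abs_integral_cos_le_of_le_abs_deriv {a b m : ℝ} (hab : a ≤ b) (hm : 0 < m)
    {φ φ' φ'' : ℝ → ℝ} (hφ : ∀ x, HasDerivAt φ (φ' x) x) (hφ' : ∀ x, HasDerivAt φ' (φ'' x) x)
    (hc : Continuous φ'') (hconv : ∀ x ∈ Set.Icc a b, 0 ≤ φ'' x)
    (hlow : ∀ x ∈ Set.Icc a b, m ≤ |φ' x|) :
    |∫ x in a..b, cos (φ x)| ≤ 4 / m := by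
  have hne : ∀ x ∈ Set.uIcc a b, φ' x ≠ 0 := by
    intro x hx h0
    rw [Set.uIcc_of_le hab] at hx
    have := hlow x hx
    rw [h0, abs_zero] at this
    linarith
  have hφc : Continuous φ := continuous_iff_continuousAt.2 fun x => (hφ x).continuousAt
  have hφ'c : Continuous φ' := continuous_iff_continuousAt.2 fun x => (hφ' x).continuousAt
  have hG : ∀ x ∈ Set.uIcc a b, HasDerivAt (fun x => -(φ' x)⁻¹) (φ'' x / φ' x ^ 2) x := by
    intro x hx
    exact (((hφ' x).inv (hne x hx)).neg).congr_deriv (by ring)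
  have hF : ∀ x ∈ Set.uIcc a b, HasDerivAt (fun x => sin (φ x) * (φ' x)⁻¹)
      (cos (φ x) - sin (φ x) * (φ'' x / φ' x ^ 2)) x := by
    intro x hx
    refine ((hφ x).sin.mul ((hφ' x).inv (hne x hx))).congr_deriv ?_
    have := hne x hx
    rw [Pi.inv_apply]
    field_simp
    ring
  have cG : ContinuousOn (fun x => φ'' x / φ' x ^ 2) (Set.uIcc a b) :=
    hc.continuousOn.div (hφ'c.pow 2).continuousOn fun x hx => pow_ne_zero 2 (hne x hx)
  have cS : ContinuousOn (fun x => sin (φ x) * (φ'' x / φ' x ^ 2)) (Set.uIcc a b) :=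
    (continuous_sin.comp hφc).continuousOn.mul cG
  have cC : ContinuousOn (fun x => cos (φ x)) (Set.uIcc a b) :=
    (continuous_cos.comp hφc).continuousOn
  have e1 := intervalIntegral.integral_eq_sub_of_hasDerivAt hG cG.intervalIntegrable
  have e2 := intervalIntegral.integral_eq_sub_of_hasDerivAt hF (cC.sub cS).intervalIntegrable
  rw [intervalIntegral.integral_sub cC.intervalIntegrable cS.intervalIntegrable] at e2
  have e3 : |∫ x in a..b, sin (φ x) * (φ'' x / φ' x ^ 2)| ≤ ∫ x in a..b, φ'' x / φ' x ^ 2 := by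
    rw [← norm_eq_abs]
    refine intervalIntegral.norm_integral_le_of_norm_le hab ?_ cG.intervalIntegrable
    refine Filter.Eventually.of_forall fun x hx => ?_
    have h0 : 0 ≤ φ'' x / φ' x ^ 2 :=
      div_nonneg (hconv x (Set.Ioc_subset_Icc_self hx)) (sq_nonneg _)
    rw [norm_mul, norm_of_nonneg h0]
    exact mul_le_of_le_one_left h0 (abs_sin_le_one _)
  have hinv : ∀ x ∈ Set.Icc a b, |(φ' x)⁻¹| ≤ m⁻¹ := fun x hx => by
    rw [abs_inv]
    exact inv_anti₀ hm (hlow x hx)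
  have ia := hinv a ⟨le_rfl, hab⟩
  have ib := hinv b ⟨hab, le_rfl⟩
  have hsin : ∀ x y : ℝ, |y| ≤ m⁻¹ → |sin x * y| ≤ m⁻¹ := fun x y h => by
    rw [abs_mul]
    exact (mul_le_of_le_one_left (abs_nonneg _) (abs_sin_le_one _)).trans h
  have ja := hsin (φ a) _ ia
  have jb := hsin (φ b) _ ib
  rw [div_eq_mul_inv]
  rw [abs_le] at *
  constructor <;> linarith [ia.1, ia.2, ib.1, ib.2]

/-- The Bessel function of integer order, through Bessel's integral. -/
def besselJ (n : ℤ) (t : ℝ) : ℝ := π⁻¹ * ∫ θ in (0 : ℝ)..π, cos (n * θ - t * sin θ)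

theorem hasDerivAt_besselPhase (ν t x : ℝ) :
    HasDerivAt (fun θ => ν * θ - t * sin θ) (ν - t * cos x) x := by
  exact (((hasDerivAt_id x).const_mul ν).sub ((hasDerivAt_sin x).const_mul t)).congr_deriv
    (by simp)

theorem hasDerivAt_deriv_besselPhase (ν t x : ℝ) :
    HasDerivAt (fun θ => ν - t * cos θ) (t * sin x) x := by
  simpa using ((hasDerivAt_cos x).const_mul t).const_sub ν

theorem besselPhase_deriv_mono {ν t p x : ℝ} (ht : 0 ≤ t) (hp : 0 ≤ p) (hpx : p ≤ x)
    (hx : x ≤ π) : ν - t * cos p ≤ ν - t * cos x := by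
  have := cos_le_cos_of_nonneg_of_le_pi hp hx hpx
  nlinarith

theorem abs_integral_besselPhase_right {ν t p m : ℝ} (ht : 0 ≤ t) (hp : 0 ≤ p) (hp' : p ≤ π)
    (hm : 0 < m) (h : m ≤ ν - t * cos p) :
    |∫ θ in p..π, cos (ν * θ - t * sin θ)| ≤ 4 / m := by
  refine abs_integral_cos_le_of_le_abs_deriv hp' hm (hasDerivAt_besselPhase ν t)
    (hasDerivAt_deriv_besselPhase ν t) (by fun_prop) (fun x hx => ?_) fun x hx => ?_
  · exact mul_nonneg ht (sin_nonneg_of_nonneg_of_le_pi (hp.trans hx.1) hx.2)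
  · exact (h.trans (besselPhase_deriv_mono ht hp hx.1 hx.2)).trans (le_abs_self _)

theorem abs_integral_besselPhase_left {ν t p m : ℝ} (ht : 0 ≤ t) (hp : 0 ≤ p) (hp' : p ≤ π)
    (hm : 0 < m) (h : ν - t * cos p ≤ -m) :
    |∫ θ in (0 : ℝ)..p, cos (ν * θ - t * sin θ)| ≤ 4 / m := by
  refine abs_integral_cos_le_of_le_abs_deriv hp hm (hasDerivAt_besselPhase ν t)
    (hasDerivAt_deriv_besselPhase ν t) (by fun_prop) (fun x hx => ?_) fun x hx => ?_
  · exact mul_nonneg ht (sin_nonneg_of_nonneg_of_le_pi hx.1 (hx.2.trans hp'))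
  · exact (le_neg.1 ((besselPhase_deriv_mono ht hx.1 hx.2 hp').trans h)).trans (neg_le_abs _)

theorem abs_integral_besselPhase_le_sub {ν t p q : ℝ} (hpq : p ≤ q) :
    |∫ θ in p..q, cos (ν * θ - t * sin θ)| ≤ q - p := by
  have := intervalIntegral.norm_integral_le_of_norm_le_const
    (f := fun θ => cos (ν * θ - t * sin θ)) (a := p) (b := q) (C := 1)
    fun x _ => by simpa using abs_cos_le_one _
  simpa [abs_of_nonneg (sub_nonneg.2 hpq)] using this

theorem intervalIntegrable_besselPhase (ν t p q : ℝ) :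
    IntervalIntegrable (fun θ => cos (ν * θ - t * sin θ)) volume p q :=
  Continuous.intervalIntegrable (by fun_prop) _ _

theorem abs_integral_besselPhase_of_lt {ν t μ : ℝ} (ht : 0 ≤ t) (htν : t < ν) (hμ : 0 < μ)
    (h : μ ^ 4 = ν ^ 2 - t ^ 2) :
    |∫ θ in (0 : ℝ)..π, cos (ν * θ - t * sin θ)| ≤ (2 + 6 * π) / μ := by
  have hπ := pi_pos
  rcases lt_or_ge (π / 2) (1 / μ) with hδ | hδ
  · refine (abs_integral_besselPhase_le_sub hπ.le).trans ?_
    calc π - 0 ≤ 2 * (1 / μ) := by linarith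
      _ ≤ (2 + 6 * π) / μ := by rw [mul_one_div]; gcongr; linarith
  set δ := 1 / μ with hδdef
  have hδ0 : 0 < δ := by positivity
  have hδμ : δ * μ = 1 := by rw [hδdef]; field_simp
  have hs : 2 / π * δ ≤ sin δ := mul_le_sin hδ0.le hδ
  have hlow : 2 * μ / π ≤ ν - t * cos δ := by
    have h1 : t * cos δ + μ ^ 2 * sin δ ≤ ν := by
      refine le_of_sq_le_sq ?_ (by linarith)
      nlinarith [sq_nonneg (t * sin δ - μ ^ 2 * cos δ), sin_sq_add_cos_sq δ]
    have h2 : μ ^ 2 * (2 / π * δ) ≤ μ ^ 2 * sin δ := by gcongr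
    have h3 : μ ^ 2 * (2 / π * δ) = 2 * μ / π * (δ * μ) := by ring
    rw [h3, hδμ] at h2
    linarith
  have h1 := abs_integral_besselPhase_right ht hδ0.le (by linarith) (by positivity) hlow
  have h2 := abs_integral_besselPhase_le_sub (ν := ν) (t := t) hδ0.le
  rw [← intervalIntegral.integral_add_adjacent_intervals
    (intervalIntegrable_besselPhase ν t 0 δ) (intervalIntegrable_besselPhase ν t δ π)]
  refine (abs_add_le _ _).trans ((add_le_add h2 h1).trans ?_)
  have : δ - 0 + 4 / (2 * μ / π) = (1 + 2 * π) / μ := by rw [hδdef]; field_simp; ring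
  rw [this]
  gcongr <;> linarith

theorem abs_integral_besselPhase_of_gt {ν t μ : ℝ} (hν : 0 ≤ ν) (htν : ν < t) (hμ : 0 < μ)
    (h : μ ^ 4 = t ^ 2 - ν ^ 2) :
    |∫ θ in (0 : ℝ)..π, cos (ν * θ - t * sin θ)| ≤ (2 + 6 * π) / μ := by
  have hπ := pi_pos
  have ht : 0 < t := by linarith
  rcases lt_or_ge (π / 2) (1 / μ) with hδ | hδ
  · refine (abs_integral_besselPhase_le_sub hπ.le).trans ?_
    calc π - 0 ≤ 2 * (1 / μ) := by linarith
      _ ≤ (2 + 6 * π) / μ := by rw [mul_one_div]; gcongr; linarith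
  set δ := 1 / μ with hδdef
  have hδ0 : 0 < δ := by positivity
  have hδμ : δ * μ = 1 := by rw [hδdef]; field_simp
  set ξ := arccos (ν / t) with hξ
  have hr0 : 0 ≤ ν / t := by positivity
  have hr1 : ν / t ≤ 1 := (div_le_one ht).2 htν.le
  have hξ0 : 0 ≤ ξ := arccos_nonneg _
  have hξ1 : ξ ≤ π / 2 := arccos_le_pi_div_two.2 hr0
  have hcos : t * cos ξ = ν := by
    rw [hξ, cos_arccos (by linarith) hr1]; field_simp
  have hsin : t * sin ξ = μ ^ 2 := by
    have h0 : 0 ≤ sin ξ := sin_nonneg_of_nonneg_of_le_pi hξ0 (by linarith)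
    refine (pow_left_inj₀ (by positivity) (by positivity) two_ne_zero).1 ?_
    have : (t * sin ξ) ^ 2 = t ^ 2 - (t * cos ξ) ^ 2 := by
      have := sin_sq_add_cos_sq ξ
      linear_combination t ^ 2 * this
    rw [this, hcos, ← h]
    ring
  have hs : 2 / π * δ ≤ sin δ := mul_le_sin hδ0.le hδ
  have hs2 : 2 / π * (δ / 2) ≤ sin (δ / 2) := mul_le_sin (by linarith) (by linarith)
  have hq : 2 * μ / π ≤ ν - t * cos (ξ + δ) := by
    have h1 : ν - t * cos (ξ + δ) = ν * (1 - cos δ) + μ ^ 2 * sin δ := by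
      rw [cos_add, ← hsin]
      linear_combination (-cos δ) * hcos
    have h2 : μ ^ 2 * (2 / π * δ) ≤ μ ^ 2 * sin δ := by gcongr
    have h3 : μ ^ 2 * (2 / π * δ) = 2 * μ / π * (δ * μ) := by ring
    rw [h3, hδμ] at h2
    have h4 : 0 ≤ ν * (1 - cos δ) := mul_nonneg hν (by linarith [cos_le_one δ])
    linarith
  have h1 := abs_integral_besselPhase_right ht.le (by positivity) (by linarith)
    (by positivity) hq
  have e1 : 4 / (2 * μ / π) = (2 * π) / μ := by field_simp; ring
  rw [e1] at h1
  rw [← intervalIntegral.integral_add_adjacent_intervals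
    (intervalIntegrable_besselPhase ν t 0 (ξ + δ)) (intervalIntegrable_besselPhase ν t (ξ + δ) π)]
  refine (abs_add_le _ _).trans ?_
  rcases le_or_gt ξ δ with hle | hgt
  · have h2 := abs_integral_besselPhase_le_sub (ν := ν) (t := t) (p := 0) (q := ξ + δ)
      (by positivity)
    have : (2 + 6 * π) / μ = 2 * δ + 2 * π / μ + 4 * π / μ := by rw [hδdef]; ring
    rw [this]
    have : 0 < 4 * π / μ := by positivity
    linarith
  · have hp : ν - t * cos (ξ - δ) ≤ -(μ / π) := by
      have h1 : ν - t * cos (ξ - δ) = -(2 * t * sin (δ / 2) * sin (ξ - δ / 2)) := by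
        have := cos_sub_cos (ξ - δ) ξ
        have e : (ξ - δ + ξ) / 2 = ξ - δ / 2 := by ring
        have e' : (ξ - δ - ξ) / 2 = -(δ / 2) := by ring
        rw [e, e', sin_neg] at this
        linear_combination (-1 : ℝ) * hcos - t * this
      have h2 : sin (ξ / 2) ≤ sin (ξ - δ / 2) :=
        sin_le_sin_of_le_of_le_pi_div_two (by linarith) (by linarith) (by linarith)
      have h3 : sin ξ ≤ 2 * sin (ξ / 2) := by
        have := sin_two_mul (ξ / 2)
        rw [mul_div_cancel₀ ξ two_ne_zero] at this
        rw [this]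
        have h0 : 0 ≤ sin (ξ / 2) := sin_nonneg_of_nonneg_of_le_pi (by linarith) (by linarith)
        nlinarith [cos_le_one (ξ / 2)]
      have h4 : 0 ≤ sin (δ / 2) := sin_nonneg_of_nonneg_of_le_pi (by linarith) (by linarith)
      have h5 : μ / π ≤ μ ^ 2 * sin (δ / 2) := by
        have h6 : μ ^ 2 * (2 / π * (δ / 2)) ≤ μ ^ 2 * sin (δ / 2) := by gcongr
        have h7 : μ ^ 2 * (2 / π * (δ / 2)) = μ / π * (δ * μ) := by ring
        rw [h7, hδμ] at h6
        linarith
      have h8 : t * sin (δ / 2) * sin ξ ≤ t * sin (δ / 2) * (2 * sin (ξ - δ / 2)) := by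
        gcongr; linarith
      rw [h1, ← hsin] at *
      linarith
    have h2 := abs_integral_besselPhase_left ht.le (by linarith) (by linarith)
      (by positivity) hp
    have h3 := abs_integral_besselPhase_le_sub (ν := ν) (t := t) (p := ξ - δ) (q := ξ + δ)
      (by linarith)
    rw [← intervalIntegral.integral_add_adjacent_intervals
      (intervalIntegrable_besselPhase ν t 0 (ξ - δ))
      (intervalIntegrable_besselPhase ν t (ξ - δ) (ξ + δ))]
    have h4 := abs_add_le (∫ θ in (0 : ℝ)..(ξ - δ), cos (ν * θ - t * sin θ))
      (∫ θ in (ξ - δ)..(ξ + δ), cos (ν * θ - t * sin θ))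
    have : (2 + 6 * π) / μ = 2 * δ + 2 * π / μ + 4 / (μ / π) := by rw [hδdef]; field_simp; ring
    rw [this]
    linarith

theorem abs_besselJ_neg (n : ℤ) (t : ℝ) : |besselJ (-n) t| = |besselJ n t| := by
  have h : ∫ θ in (0 : ℝ)..π, cos ((-n : ℤ) * θ - t * sin θ)
      = cos (n * π) * ∫ θ in (0 : ℝ)..π, cos (n * θ - t * sin θ) := by
    rw [← intervalIntegral.integral_const_mul]
    have := intervalIntegral.integral_comp_sub_left (a := 0) (b := π)
      (fun θ => cos ((-n : ℤ) * θ - t * sin θ)) π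
    rw [sub_self, sub_zero] at this
    rw [← this]
    refine intervalIntegral.integral_congr fun θ _ => ?_
    have e : ((-n : ℤ) : ℝ) * (π - θ) - t * sin (π - θ) = (n * θ - t * sin θ) - n * π := by
      rw [sin_pi_sub]; push_cast; ring
    simp only [e]
    rw [cos_sub, sin_int_mul_pi]
    ring
  rw [besselJ, h, besselJ, mul_left_comm, abs_mul, cos_int_mul_pi, abs_neg_one_zpow, one_mul]

theorem abs_besselJ_le_one (n : ℤ) (t : ℝ) : |besselJ n t| ≤ 1 := by
  rw [besselJ, abs_mul, abs_of_pos (by positivity)]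
  have := abs_integral_besselPhase_le_sub (ν := n) (t := t) pi_pos.le
  rw [sub_zero] at this
  exact inv_mul_le_one_of_le₀ this pi_pos.le

theorem abs_besselJ_le (n : ℤ) {t : ℝ} (ht : 0 ≤ t) (htn : t ≠ |(n : ℝ)|) :
    |besselJ n t| ≤ 8 * |t ^ 2 - (n : ℝ) ^ 2| ^ (-(1 / 4) : ℝ) := by
  wlog hn : 0 ≤ n generalizing n
  · have := this (-n) (by simpa using htn) (by omega)
    rw [abs_besselJ_neg] at this
    simpa using this
  have hn' : (0 : ℝ) ≤ n := by exact_mod_cast hn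
  rw [abs_of_nonneg hn'] at htn
  set μ := |t ^ 2 - (n : ℝ) ^ 2| ^ (1 / 4 : ℝ) with hμd
  have hne : t ^ 2 - (n : ℝ) ^ 2 ≠ 0 := by
    intro h0
    exact htn ((pow_left_inj₀ ht hn' two_ne_zero).1 (by linarith))
  have hμ : 0 < μ := rpow_pos_of_pos (abs_pos.2 hne) _
  have hμ4 : μ ^ 4 = |t ^ 2 - (n : ℝ) ^ 2| := by
    rw [hμd, ← rpow_natCast, ← rpow_mul (abs_nonneg _)]; norm_num
  have key : |∫ θ in (0 : ℝ)..π, cos (n * θ - t * sin θ)| ≤ (2 + 6 * π) / μ := by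
    rcases lt_or_gt_of_ne htn with h | h
    · refine abs_integral_besselPhase_of_lt ht h hμ ?_
      rw [hμ4, abs_of_neg (by nlinarith)]; ring
    · refine abs_integral_besselPhase_of_gt hn' h hμ ?_
      rw [hμ4, abs_of_pos (by nlinarith)]
  rw [rpow_neg (abs_nonneg _), ← hμd, besselJ, abs_mul, abs_of_pos (by positivity),
    inv_mul_le_iff₀ pi_pos]
  refine key.trans ?_
  rw [div_eq_mul_inv, ← mul_assoc]
  gcongr
  linarith [pi_gt_three]

theorem hasDerivAt_besselJ (n : ℤ) (t : ℝ) :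
    HasDerivAt (besselJ n) ((besselJ (n - 1) t - besselJ (n + 1) t) / 2) t := by
  have h := (intervalIntegral.hasDerivAt_integral_of_dominated_loc_of_deriv_le
    (μ := volume) (a := 0) (b := π) (x₀ := t) (s := Set.univ) (bound := fun _ => 1)
    (F := fun t θ => cos (n * θ - t * sin θ))
    (F' := fun t θ => sin θ * sin (n * θ - t * sin θ))
    Filter.univ_mem
    (Filter.Eventually.of_forall fun t => Continuous.aestronglyMeasurable (by fun_prop))
    (intervalIntegrable_besselPhase _ _ _ _)
    (Continuous.aestronglyMeasurable (by fun_prop))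
    (Filter.Eventually.of_forall fun θ _ x _ => ?_) intervalIntegrable_const
    (Filter.Eventually.of_forall fun θ _ x _ => ?_)).2
  · refine (h.const_mul π⁻¹).congr_deriv ?_
    rw [besselJ, besselJ, ← mul_sub, ← intervalIntegral.integral_sub
      (intervalIntegrable_besselPhase _ _ _ _) (intervalIntegrable_besselPhase _ _ _ _),
      mul_div_assoc, ← intervalIntegral.integral_div]
    congr 1
    refine intervalIntegral.integral_congr fun θ _ => ?_
    have e1 : ((n - 1 : ℤ) : ℝ) * θ - t * sin θ = (n * θ - t * sin θ) - θ := by push_cast; ring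
    have e2 : ((n + 1 : ℤ) : ℝ) * θ - t * sin θ = (n * θ - t * sin θ) + θ := by push_cast; ring
    simp only [e1, e2, cos_sub _ θ, cos_add _ θ]
    ring
  · rw [norm_mul]
    exact mul_le_one₀ (abs_sin_le_one _) (norm_nonneg _) (abs_sin_le_one _)
  · have := (((hasDerivAt_id x).mul_const (sin θ)).const_sub (n * θ)).cos
    exact this.congr_deriv (by simp; ring)

theorem continuous_besselJ (n : ℤ) : Continuous (besselJ n) :=
  continuous_iff_continuousAt.2 fun t => (hasDerivAt_besselJ n t).continuousAt

theorem besselJ_zero (n : ℤ) : besselJ n 0 = if n = 0 then 1 else 0 := by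
  rw [besselJ]
  split_ifs with h
  · simp [h]
  · have hn : (n : ℝ) ≠ 0 := by exact_mod_cast h
    simp only [zero_mul, sub_zero]
    rw [intervalIntegral.integral_comp_mul_left cos hn]
    simp [sin_int_mul_pi]

theorem tendsto_besselJ_atTop (n : ℤ) :
    Filter.Tendsto (besselJ n) Filter.atTop (nhds 0) := by
  have h1 : Filter.Tendsto (fun t : ℝ => t ^ 2 - (n : ℝ) ^ 2) Filter.atTop Filter.atTop :=
    Filter.tendsto_atTop_add_const_right _ _ (Filter.tendsto_pow_atTop two_ne_zero)
  have h2 := ((tendsto_rpow_neg_atTop (y := 1 / 4) (by norm_num)).comp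
    (Filter.tendsto_abs_atTop_atTop.comp h1)).const_mul 8
  rw [mul_zero] at h2
  refine squeeze_zero_norm' ?_ h2
  filter_upwards [Filter.eventually_gt_atTop |(n : ℝ)|] with t ht
  exact abs_besselJ_le n ((abs_nonneg _).trans ht.le) ht.ne'

/-- The cubic moment of a Bessel function. -/
def besselMoment (n : ℤ) : ℝ≥0∞ := ∫⁻ t in Set.Ioi (0 : ℝ), ‖besselJ n t‖ₑ ^ 3

theorem lintegral_enorm_pow_three_le {s : Set ℝ} (hs : MeasurableSet s) {f g : ℝ → ℝ}
    (hg : IntegrableOn g s) (h : ∀ t ∈ s, |f t| ^ 3 ≤ g t) :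
    ∫⁻ t in s, ‖f t‖ₑ ^ 3 ≤ ENNReal.ofReal (∫ t in s, g t) := by
  rw [ofReal_integral_eq_lintegral_ofReal hg]
  · refine setLIntegral_mono' hs fun t ht => ?_
    rw [← ofReal_norm, ← ENNReal.ofReal_pow (norm_nonneg _)]
    exact ENNReal.ofReal_le_ofReal (h t ht)
  · filter_upwards [ae_restrict_mem hs] with t ht
    exact (by positivity : 0 ≤ |f t| ^ 3).trans (h t ht)

theorem abs_besselJ_pow_three_le (n : ℤ) {t : ℝ} (ht : 0 ≤ t) (htn : t ≠ |(n : ℝ)|) :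
    |besselJ n t| ^ 3 ≤ 512 * |t ^ 2 - (n : ℝ) ^ 2| ^ (-(3 / 4) : ℝ) := by
  refine (pow_le_pow_left₀ (abs_nonneg _) (abs_besselJ_le n ht htn) 3).trans_eq ?_
  rw [mul_pow, ← rpow_natCast (_ ^ _), ← rpow_mul (abs_nonneg _)]
  norm_num

theorem integrableOn_Ioi_rpow_neg {c : ℝ} (hc : 0 < c) :
    IntegrableOn (fun t : ℝ => t ^ (-(3 / 2) : ℝ)) (Set.Ioi c) :=
  integrableOn_Ioi_rpow_of_lt (by norm_num) hc

theorem integral_Ioi_rpow_neg {c : ℝ} (hc : 0 < c) :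
    ∫ t in Set.Ioi c, t ^ (-(3 / 2) : ℝ) = 2 * c ^ (-(1 / 2) : ℝ) := by
  rw [integral_Ioi_rpow_of_lt (by norm_num) hc]
  norm_num
  ring

theorem besselMoment_zero_lt_top : besselMoment 0 < ∞ := by
  have h1 : ∫⁻ t in Set.Ioc (0 : ℝ) 1, ‖besselJ 0 t‖ₑ ^ 3 < ∞ :=
    (lintegral_enorm_pow_three_le (g := fun _ => 1) measurableSet_Ioc
      (integrableOn_const (by simp)) fun t _ =>
        pow_le_one₀ (abs_nonneg _) (abs_besselJ_le_one 0 t)).trans_lt ENNReal.ofReal_lt_top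
  have h2 : ∫⁻ t in Set.Ioi (1 : ℝ), ‖besselJ 0 t‖ₑ ^ 3 < ∞ := by
    refine (lintegral_enorm_pow_three_le (g := fun t => 512 * t ^ (-(3 / 2) : ℝ))
      measurableSet_Ioi ((integrableOn_Ioi_rpow_neg one_pos).const_mul _) fun t ht => ?_).trans_lt
        ENNReal.ofReal_lt_top
    have ht' : (0 : ℝ) < t := one_pos.trans ht
    refine (abs_besselJ_pow_three_le 0 ht'.le (by simpa using ht'.ne')).trans_eq ?_
    rw [Int.cast_zero, zero_pow two_ne_zero, sub_zero, abs_of_pos (by positivity),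
      ← rpow_natCast t, ← rpow_mul ht'.le]
    norm_num
  rw [besselMoment, ← Set.Ioc_union_Ioi_eq_Ioi zero_le_one]
  exact (lintegral_union_le _ _ _).trans_lt (ENNReal.add_lt_top.2 ⟨h1, h2⟩)

theorem integral_rpow_neg_three_quarters {c : ℝ} :
    ∫ t in (0 : ℝ)..c, t ^ (-(3 / 4) : ℝ) = 4 * c ^ (1 / 4 : ℝ) := by
  rw [integral_rpow (Or.inl (by norm_num))]
  norm_num
  ring

theorem besselMoment_le {n : ℤ} (hn : n ≠ 0) :
    besselMoment n ≤ ENNReal.ofReal (8000 * |(n : ℝ)| ^ (-(1 / 2) : ℝ)) := by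
  set N := |(n : ℝ)| with hN
  have hN0 : 0 < N := abs_pos.2 (by exact_mod_cast hn)
  have hNn : (n : ℝ) ^ 2 = N ^ 2 := (sq_abs _).symm
  set c := 512 * N ^ (-(3 / 4) : ℝ) with hc
  have hc0 : 0 ≤ c := by positivity
  have hcN : c * (4 * N ^ (1 / 4 : ℝ)) = 2048 * N ^ (-(1 / 2) : ℝ) := by
    have : N ^ (-(1 / 2) : ℝ) = N ^ (-(3 / 4) : ℝ) * N ^ (1 / 4 : ℝ) := by
      rw [← rpow_add hN0]; norm_num
    rw [this, hc]; ring
  have hrp : ∀ a b : ℝ, IntervalIntegrable (fun t : ℝ => t ^ (-(3 / 4) : ℝ)) volume a b :=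
    fun a b => intervalIntegral.intervalIntegrable_rpow' (by norm_num)
  have hnear : ∀ t : ℝ, 0 ≤ t → t ≠ N →
      |besselJ n t| ^ 3 ≤ c * |t - N| ^ (-(3 / 4) : ℝ) := by
    intro t ht0 htN
    refine (abs_besselJ_pow_three_le n ht0 htN).trans ?_
    rw [hc, mul_assoc, ← mul_rpow hN0.le (abs_nonneg _), hNn]
    have h0 : 0 < |t - N| := abs_pos.2 (sub_ne_zero.2 htN)
    refine mul_le_mul_of_nonneg_left
      (rpow_le_rpow_of_nonpos (by positivity) ?_ (by norm_num)) (by norm_num)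
    rw [sq_sub_sq, abs_mul, abs_of_nonneg (by linarith : 0 ≤ t + N)]
    gcongr
    linarith
  have h1 : ∫⁻ t in Set.Ioo 0 N, ‖besselJ n t‖ₑ ^ 3
      ≤ ENNReal.ofReal (2048 * N ^ (-(1 / 2) : ℝ)) := by
    have hi : IntegrableOn (fun t => c * (N - t) ^ (-(3 / 4) : ℝ)) (Set.Ioo 0 N) := by
      have := (hrp N 0).comp_sub_left N
      rw [sub_self, sub_zero, intervalIntegrable_iff_integrableOn_Ioo_of_le hN0.le] at this
      exact this.const_mul c
    refine (lintegral_enorm_pow_three_le measurableSet_Ioo hi fun t ht => ?_).trans_eq ?_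
    · have := hnear t ht.1.le ht.2.ne
      rwa [abs_of_neg (sub_neg.2 ht.2), neg_sub] at this
    · rw [← integral_Ioc_eq_integral_Ioo, ← intervalIntegral.integral_of_le hN0.le,
        intervalIntegral.integral_const_mul,
        intervalIntegral.integral_comp_sub_left (fun t => t ^ (-(3 / 4) : ℝ)), sub_self, sub_zero,
        integral_rpow_neg_three_quarters, hcN]
  have h2 : ∫⁻ t in Set.Ioc N (2 * N), ‖besselJ n t‖ₑ ^ 3
      ≤ ENNReal.ofReal (2048 * N ^ (-(1 / 2) : ℝ)) := by
    have hi : IntegrableOn (fun t => c * (t - N) ^ (-(3 / 4) : ℝ)) (Set.Ioc N (2 * N)) := by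
      have := (hrp 0 N).comp_sub_right N
      rw [zero_add, ← two_mul, intervalIntegrable_iff_integrableOn_Ioc_of_le (by linarith)] at this
      exact this.const_mul c
    refine (lintegral_enorm_pow_three_le measurableSet_Ioc hi fun t ht => ?_).trans_eq ?_
    · have := hnear t (hN0.trans ht.1).le ht.1.ne'
      rwa [abs_of_pos (sub_pos.2 ht.1)] at this
    · rw [← intervalIntegral.integral_of_le (by linarith),
        intervalIntegral.integral_const_mul,
        intervalIntegral.integral_comp_sub_right (fun t => t ^ (-(3 / 4) : ℝ)), sub_self,
        show 2 * N - N = N by ring, integral_rpow_neg_three_quarters, hcN]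
  have h3 : ∫⁻ t in Set.Ioi (2 * N), ‖besselJ n t‖ₑ ^ 3
      ≤ ENNReal.ofReal (2048 * N ^ (-(1 / 2) : ℝ)) := by
    refine (lintegral_enorm_pow_three_le (g := fun t => 1024 * t ^ (-(3 / 2) : ℝ))
      measurableSet_Ioi ((integrableOn_Ioi_rpow_neg (by positivity)).const_mul _)
      fun t ht => ?_).trans ?_
    · have ht : 2 * N < t := ht
      have ht0 : 0 < t := by linarith
      have h4 : t ^ (-(3 / 2) : ℝ) = (t ^ 2) ^ (-(3 / 4) : ℝ) := by
        rw [← rpow_natCast t, ← rpow_mul ht0.le]; norm_num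
      have h5 : ((1 : ℝ) / 2) ^ (-(3 / 4) : ℝ) ≤ 2 := by
        calc ((1 : ℝ) / 2) ^ (-(3 / 4) : ℝ) ≤ ((1 : ℝ) / 2) ^ (-1 : ℝ) :=
              rpow_le_rpow_of_exponent_ge (by norm_num) (by norm_num) (by norm_num)
          _ = 2 := by rw [rpow_neg_one]; norm_num
      refine (abs_besselJ_pow_three_le n ht0.le (by linarith)).trans ?_
      calc 512 * |t ^ 2 - (n : ℝ) ^ 2| ^ (-(3 / 4) : ℝ)
          ≤ 512 * (1 / 2 * t ^ 2) ^ (-(3 / 4) : ℝ) := by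
            refine mul_le_mul_of_nonneg_left
              (rpow_le_rpow_of_nonpos (by positivity) ?_ (by norm_num)) (by norm_num)
            rw [hNn]
            exact le_trans (by nlinarith) (le_abs_self _)
        _ = 512 * (((1 : ℝ) / 2) ^ (-(3 / 4) : ℝ) * (t ^ 2) ^ (-(3 / 4) : ℝ)) := by
            rw [mul_rpow (by norm_num) (by positivity)]
        _ ≤ 512 * (2 * (t ^ 2) ^ (-(3 / 4) : ℝ)) := by gcongr
        _ = 1024 * t ^ (-(3 / 2) : ℝ) := by rw [h4]; ring
    · rw [integral_const_mul, integral_Ioi_rpow_neg (by positivity)]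
      refine ENNReal.ofReal_le_ofReal ?_
      have : (2 * N) ^ (-(1 / 2) : ℝ) ≤ N ^ (-(1 / 2) : ℝ) :=
        rpow_le_rpow_of_nonpos hN0 (by linarith) (by norm_num)
      linarith
  have hunion : Set.Ioi (0 : ℝ) ⊆
      ((Set.Ioo 0 N ∪ {N}) ∪ Set.Ioc N (2 * N)) ∪ Set.Ioi (2 * N) := by
    intro t ht
    simp only [Set.mem_union, Set.mem_Ioo, Set.mem_singleton_iff, Set.mem_Ioc, Set.mem_Ioi] at *
    rcases lt_trichotomy t N with h | h | h
    · tauto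
    · tauto
    · rcases le_or_gt t (2 * N) with h' | h' <;> tauto
  have hzero : ∫⁻ t in {N}, ‖besselJ n t‖ₑ ^ 3 = 0 := by simp
  calc besselMoment n ≤ _ := lintegral_mono_set hunion
    _ ≤ ((∫⁻ t in Set.Ioo 0 N, ‖besselJ n t‖ₑ ^ 3) + (∫⁻ t in {N}, ‖besselJ n t‖ₑ ^ 3)
        + ∫⁻ t in Set.Ioc N (2 * N), ‖besselJ n t‖ₑ ^ 3)
        + ∫⁻ t in Set.Ioi (2 * N), ‖besselJ n t‖ₑ ^ 3 := by
        refine (lintegral_union_le _ _ _).trans (add_le_add_left ?_ _)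
        refine (lintegral_union_le _ _ _).trans (add_le_add_left ?_ _)
        exact lintegral_union_le _ _ _
    _ ≤ (ENNReal.ofReal (2048 * N ^ (-(1 / 2) : ℝ)) + 0
        + ENNReal.ofReal (2048 * N ^ (-(1 / 2) : ℝ)))
        + ENNReal.ofReal (2048 * N ^ (-(1 / 2) : ℝ)) := by gcongr; exact hzero.le
    _ ≤ _ := by
      rw [add_zero, ← ENNReal.ofReal_add (by positivity) (by positivity),
        ← ENNReal.ofReal_add (by positivity) (by positivity)]
      refine ENNReal.ofReal_le_ofReal ?_
      have : 0 ≤ N ^ (-(1 / 2) : ℝ) := by positivity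
      linarith

theorem tsum_besselMoment_rpow_lt_top : ∑' n : ℤ, besselMoment n ^ (7 / 3 : ℝ) < ∞ := by
  have hs : Summable fun n : ℤ => (8000 : ℝ) ^ (7 / 3 : ℝ) * |(n : ℝ)| ^ (-(7 / 6) : ℝ) :=
    (summable_abs_int_rpow (by norm_num)).mul_left _
  have hb : ∀ n : ℤ, besselMoment n ^ (7 / 3 : ℝ) ≤
      (if n = 0 then besselMoment 0 ^ (7 / 3 : ℝ) else 0) +
      ENNReal.ofReal ((8000 : ℝ) ^ (7 / 3 : ℝ) * |(n : ℝ)| ^ (-(7 / 6) : ℝ)) := by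
    intro n
    split_ifs with h
    · rw [h]; exact le_self_add
    · rw [zero_add]
      refine (ENNReal.rpow_le_rpow (besselMoment_le h) (by norm_num)).trans_eq ?_
      rw [ENNReal.ofReal_rpow_of_nonneg (by positivity) (by norm_num),
        mul_rpow (by norm_num) (by positivity), ← rpow_mul (abs_nonneg _)]
      norm_num
  refine (ENNReal.tsum_le_tsum hb).trans_lt ?_
  rw [ENNReal.tsum_add, tsum_ite_eq]
  exact ENNReal.add_lt_top.2 ⟨ENNReal.rpow_lt_top_of_nonneg (by norm_num)
    besselMoment_zero_lt_top.ne, hs.tsum_ofReal_lt_top⟩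

theorem ENNReal.tsum_prod_fin_eq_pow (f : ℤ → ℝ≥0∞) (n : ℕ) :
    ∑' x : Fin n → ℤ, ∏ j, f (x j) = (∑' k, f k) ^ n := by
  induction n with
  | zero => simp
  | succ n ih =>
    rw [← (Fin.consEquiv fun _ : Fin (n + 1) => ℤ).tsum_eq, ENNReal.tsum_prod', pow_succ', ← ih,
      ← ENNReal.tsum_mul_right]
    refine tsum_congr fun a => ?_
    rw [← ENNReal.tsum_mul_left]
    refine tsum_congr fun b => ?_
    simp [Fin.consEquiv, Fin.prod_univ_succ]

/-- The fundamental solution `exp(itH)δ₀` of the Schrödinger equation on `ℤ^d`, where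
`H` is half the sum of the shifts to the neighbours. -/
def schrodingerKernel {d : ℕ} (t : ℝ) (x : Fin d → ℤ) : ℂ :=
  ∏ j, Complex.I ^ (x j) * besselJ (x j) t

theorem continuous_schrodingerKernel {d : ℕ} (x : Fin d → ℤ) :
    Continuous fun t => schrodingerKernel t x :=
  continuous_finsetProd _ fun j _ =>
    continuous_const.mul (Complex.continuous_ofReal.comp (continuous_besselJ (x j)))

theorem norm_schrodingerKernel {d : ℕ} (t : ℝ) (x : Fin d → ℤ) :
    ‖schrodingerKernel t x‖ = ∏ j, |besselJ (x j) t| := by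
  simp [schrodingerKernel, norm_prod]

theorem schrodingerKernel_zero {d : ℕ} (x : Fin d → ℤ) :
    schrodingerKernel 0 x = if x = 0 then 1 else 0 := by
  rw [schrodingerKernel]
  split_ifs with h
  · simp [h, besselJ_zero]
  · obtain ⟨j, hj⟩ := Function.ne_iff.1 h
    refine Finset.prod_eq_zero (Finset.mem_univ j) ?_
    rw [besselJ_zero, if_neg (by simpa using hj)]
    simp

theorem schrodingerKernel_add_single {d : ℕ} (t : ℝ) (x : Fin d → ℤ) (j : Fin d) (c : ℤ) :
    schrodingerKernel t (x + Pi.single j c) = (Complex.I ^ (x j + c) * besselJ (x j + c) t) *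
      ∏ i ∈ Finset.univ.erase j, Complex.I ^ (x i) * (besselJ (x i) t : ℂ) := by
  rw [schrodingerKernel, ← Finset.mul_prod_erase _ _ (Finset.mem_univ j)]
  congr 1
  · simp
  · refine Finset.prod_congr rfl fun i hi => ?_
    simp [Finset.ne_of_mem_erase hi]

theorem hasDerivAt_schrodingerKernel {d : ℕ} (t : ℝ) (x : Fin d → ℤ) :
    HasDerivAt (fun t => schrodingerKernel t x)
      (Complex.I / 2 * ∑ j, (schrodingerKernel t (x + Pi.single j 1) +
        schrodingerKernel t (x - Pi.single j 1))) t := by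
  have h := HasDerivAt.fun_finsetProd (u := Finset.univ) (x := t)
    (f := fun j t => Complex.I ^ (x j) * (besselJ (x j) t : ℂ))
    fun j _ => ((hasDerivAt_besselJ (x j) t).ofReal_comp).const_mul (Complex.I ^ (x j))
  refine h.congr_deriv ?_
  rw [Finset.mul_sum]
  refine Finset.sum_congr rfl fun j _ => ?_
  rw [sub_eq_add_neg x, ← Pi.single_neg, schrodingerKernel_add_single, schrodingerKernel_add_single,
    zpow_add₀ Complex.I_ne_zero, zpow_add₀ Complex.I_ne_zero, zpow_neg_one, Complex.inv_I, zpow_one,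
    ← sub_eq_add_neg (x j), smul_eq_mul]
  push_cast
  linear_combination (-(∏ i ∈ Finset.univ.erase j, Complex.I ^ (x i) * (besselJ (x i) t : ℂ)) *
    Complex.I ^ (x j) / 2 * (besselJ (x j + 1) t - besselJ (x j - 1) t : ℂ)) * Complex.I_sq

theorem lintegral_enorm_schrodingerKernel_le (x : Fin 3 → ℤ) :
    ∫⁻ t in Set.Ioi (0 : ℝ), ‖schrodingerKernel t x‖ₑ
      ≤ ∏ j, besselMoment (x j) ^ (1 / 3 : ℝ) := by
  have h := ENNReal.lintegral_prod_norm_pow_le (μ := volume.restrict (Set.Ioi (0 : ℝ)))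
    (Finset.univ : Finset (Fin 3)) (f := fun j t => ‖besselJ (x j) t‖ₑ ^ 3)
    (fun j _ => ((continuous_besselJ (x j)).enorm.measurable.pow_const 3).aemeasurable)
    (p := fun _ => 1 / 3) (by norm_num) (fun _ _ => by norm_num)
  refine le_trans (lintegral_mono fun t => ?_) h
  rw [← ofReal_norm, norm_schrodingerKernel,
    ENNReal.ofReal_prod_of_nonneg fun _ _ => abs_nonneg _]
  refine Finset.prod_le_prod' fun j _ => ?_
  rw [← ENNReal.rpow_natCast, ← ENNReal.rpow_mul, ← ofReal_norm, norm_eq_abs]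
  norm_num

theorem enorm_exp_I_mul_le_one {w : ℂ} (hw : 0 ≤ w.im) {t : ℝ} (ht : 0 ≤ t) :
    ‖Complex.exp (Complex.I * t * w)‖ₑ ≤ 1 := by
  rw [← ofReal_norm, Complex.norm_exp]
  refine ENNReal.ofReal_le_one.2 (exp_le_one_iff.2 ?_)
  simp
  positivity

theorem besselMoment_lt_top (n : ℤ) : besselMoment n < ∞ := by
  by_cases h : n = 0
  · rw [h]; exact besselMoment_zero_lt_top
  · exact (besselMoment_le h).trans_lt ENNReal.ofReal_lt_top

/-- The resolvent kernel of `H` as a Laplace transform of the Schrödinger kernel. -/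
def resolventKernel {d : ℕ} (w : ℂ) (x : Fin d → ℤ) : ℂ :=
  ∫ t in Set.Ioi (0 : ℝ), Complex.exp (Complex.I * t * w) * schrodingerKernel t x

theorem lintegral_enorm_exp_mul_schrodingerKernel_le {w : ℂ} (hw : 0 ≤ w.im) (x : Fin 3 → ℤ) :
    ∫⁻ t in Set.Ioi (0 : ℝ), ‖Complex.exp (Complex.I * t * w) * schrodingerKernel t x‖ₑ
      ≤ ∏ j, besselMoment (x j) ^ (1 / 3 : ℝ) := by
  refine le_trans (setLIntegral_mono' measurableSet_Ioi fun t ht => ?_)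
    (lintegral_enorm_schrodingerKernel_le x)
  rw [enorm_mul]
  exact mul_le_of_le_one_left zero_le (enorm_exp_I_mul_le_one hw (le_of_lt ht))

theorem integrableOn_exp_mul_schrodingerKernel {w : ℂ} (hw : 0 ≤ w.im) (x : Fin 3 → ℤ) :
    IntegrableOn (fun t : ℝ => Complex.exp (Complex.I * t * w) * schrodingerKernel t x)
      (Set.Ioi 0) := by
  have hc := continuous_schrodingerKernel x
  refine ⟨Continuous.aestronglyMeasurable (by fun_prop), ?_⟩
  refine (lintegral_enorm_exp_mul_schrodingerKernel_le hw x).trans_lt ?_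
  exact ENNReal.prod_lt_top fun j _ =>
    ENNReal.rpow_lt_top_of_nonneg (by norm_num) (besselMoment_lt_top _).ne

theorem tsum_enorm_resolventKernel_pow_le {w : ℂ} (hw : 0 ≤ w.im) :
    ∑' x : Fin 3 → ℤ, ‖resolventKernel w x‖ₑ ^ (7 : ℝ)
      ≤ (∑' n : ℤ, besselMoment n ^ (7 / 3 : ℝ)) ^ 3 := by
  rw [← ENNReal.tsum_prod_fin_eq_pow]
  refine ENNReal.tsum_le_tsum fun x => ?_
  refine (ENNReal.rpow_le_rpow ((enorm_integral_le_lintegral_enorm _).trans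
    (lintegral_enorm_exp_mul_schrodingerKernel_le hw x)) (by norm_num)).trans_eq ?_
  rw [← ENNReal.prod_rpow_of_nonneg (by norm_num)]
  refine Finset.prod_congr rfl fun j _ => ?_
  rw [← ENNReal.rpow_mul]
  norm_num

theorem resolventKernel_equation {w : ℂ} (hw : 0 ≤ w.im) (x : Fin 3 → ℤ) :
    w * resolventKernel w x + 1 / 2 * ∑ j, (resolventKernel w (x + Pi.single j 1) +
      resolventKernel w (x - Pi.single j 1)) = if x = 0 then Complex.I else 0 := by
  have hi := integrableOn_exp_mul_schrodingerKernel hw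
  have hd : ∀ t : ℝ, HasDerivAt
      (fun t : ℝ => Complex.exp (Complex.I * t * w) * schrodingerKernel t x)
      (Complex.I * (w * (Complex.exp (Complex.I * t * w) * schrodingerKernel t x) +
        1 / 2 * ∑ j, (Complex.exp (Complex.I * t * w) * schrodingerKernel t (x + Pi.single j 1) +
        Complex.exp (Complex.I * t * w) * schrodingerKernel t (x - Pi.single j 1)))) t := by
    intro t
    have h1 : HasDerivAt (fun t : ℝ => Complex.exp (Complex.I * t * w))
        (Complex.exp (Complex.I * t * w) * (Complex.I * w)) t := by
      have := (((hasDerivAt_id t).ofReal_comp.const_mul Complex.I).mul_const w).cexp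
      simpa using this
    refine (h1.mul (hasDerivAt_schrodingerKernel t x)).congr_deriv ?_
    simp only [← mul_add, ← Finset.mul_sum]
    ring
  have h0 : Filter.Tendsto
      (fun t : ℝ => Complex.exp (Complex.I * t * w) * schrodingerKernel t x)
      Filter.atTop (nhds 0) := by
    have hJ : Filter.Tendsto (fun t => |besselJ (x 0) t|) Filter.atTop (nhds 0) := by
      simpa using (tendsto_besselJ_atTop (x 0)).abs
    refine squeeze_zero_norm' ?_ hJ
    filter_upwards [Filter.eventually_ge_atTop 0] with t ht
    have h1 : ‖Complex.exp (Complex.I * t * w)‖ ≤ 1 := by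
      have := enorm_exp_I_mul_le_one hw ht
      rwa [← ofReal_norm, ENNReal.ofReal_le_one] at this
    rw [norm_mul, norm_schrodingerKernel, Fin.prod_univ_succ]
    have h2 : ∏ i : Fin 2, |besselJ (x i.succ) t| ≤ 1 :=
      Finset.prod_le_one (fun _ _ => abs_nonneg _) fun _ _ => abs_besselJ_le_one _ _
    have h3 : 0 ≤ ∏ i : Fin 2, |besselJ (x i.succ) t| :=
      Finset.prod_nonneg fun _ _ => abs_nonneg _
    refine (mul_le_of_le_one_left (mul_nonneg (abs_nonneg _) h3) h1).trans ?_
    exact mul_le_of_le_one_right (abs_nonneg _) h2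
  have hadd : ∀ j : Fin 3, IntegrableOn (fun t : ℝ =>
      Complex.exp (Complex.I * t * w) * schrodingerKernel t (x + Pi.single j 1) +
        Complex.exp (Complex.I * t * w) * schrodingerKernel t (x - Pi.single j 1))
      (Set.Ioi 0) := fun j => (hi _).add (hi _)
  have hsum : IntegrableOn (fun t : ℝ =>
      ∑ j, (Complex.exp (Complex.I * t * w) * schrodingerKernel t (x + Pi.single j 1) +
        Complex.exp (Complex.I * t * w) * schrodingerKernel t (x - Pi.single j 1)))
      (Set.Ioi 0) := integrable_finsetSum _ fun j _ => hadd j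
  have key := integral_Ioi_of_hasDerivAt_of_tendsto' (fun t _ => hd t)
    ((((hi x).const_mul w).add (hsum.const_mul (1 / 2))).const_mul Complex.I) h0
  rw [integral_const_mul, integral_add ((hi x).const_mul w) (hsum.const_mul (1 / 2)),
    integral_const_mul, integral_const_mul,
    integral_finsetSum _ (fun j _ => hadd j), schrodingerKernel_zero] at key
  have e : ∀ j : Fin 3, ∫ t in Set.Ioi (0 : ℝ),
      (Complex.exp (Complex.I * t * w) * schrodingerKernel t (x + Pi.single j 1) +
        Complex.exp (Complex.I * t * w) * schrodingerKernel t (x - Pi.single j 1)) =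
      resolventKernel w (x + Pi.single j 1) + resolventKernel w (x - Pi.single j 1) :=
    fun j => integral_add (hi _) (hi _)
  simp only [e] at key
  rw [resolventKernel]
  simp only [Complex.ofReal_zero, mul_zero, zero_mul, Complex.exp_zero, one_mul, zero_sub] at key
  have := congrArg (fun z => -Complex.I * z) key
  simp only [← mul_assoc, neg_mul, Complex.I_mul_I, neg_neg, one_mul, mul_neg, mul_ite, mul_one,
    mul_zero] at this
  rw [this]
  split_ifs <;> simp

/-- The convolution kernel of `1 - Δ - μ` on `ℤ^d`. -/
def laplaceKernel (d : ℕ) (μ : ℂ) (x : Fin d → ℤ) : ℂ :=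
  (1 + 2 * d - μ) * (if x = 0 then 1 else 0) -
    ∑ j, ((if x = Pi.single j 1 then 1 else 0) + if x = -Pi.single j 1 then 1 else 0)

/-- Uniformly bounded fundamental solutions of `1 - Δ - μ` on `ℤ³`. -/
theorem exists_fundamentalSolution (μ : ℂ) : ∃ K : (Fin 3 → ℤ) → ℂ,
    ∑' x, ‖K x‖ₑ ^ (7 : ℝ) ≤ (∑' n : ℤ, besselMoment n ^ (7 / 3 : ℝ)) ^ 3 ∧
    ∀ x, (7 - μ) * K x - ∑ j, (K (x + Pi.single j 1) + K (x - Pi.single j 1)) =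
      if x = 0 then 1 else 0 := by
  set w := -(7 - μ) / 2 with hw
  rcases le_total 0 w.im with h | h
  · refine ⟨fun x => Complex.I / 2 * resolventKernel w x, ?_, fun x => ?_⟩
    · refine (ENNReal.tsum_le_tsum fun x => ?_).trans (tsum_enorm_resolventKernel_pow_le h)
      refine ENNReal.rpow_le_rpow ?_ (by norm_num)
      rw [enorm_mul]
      refine mul_le_of_le_one_left zero_le ?_
      rw [← ofReal_norm, ENNReal.ofReal_le_one]
      norm_num
    · have := resolventKernel_equation h x
      rw [show 7 - μ = -2 * w by rw [hw]; ring]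
      simp only [← mul_add, ← Finset.mul_sum]
      have e : (if x = 0 then (1 : ℂ) else 0) = -Complex.I * if x = 0 then Complex.I else 0 := by
        split_ifs <;> simp
      rw [e, ← this]
      ring
  · have h' : 0 ≤ (starRingEnd ℂ w).im := by simpa using h
    refine ⟨fun x => -(Complex.I / 2) * starRingEnd ℂ (resolventKernel (starRingEnd ℂ w) x), ?_,
      fun x => ?_⟩
    · refine (ENNReal.tsum_le_tsum fun x => ?_).trans (tsum_enorm_resolventKernel_pow_le h')
      refine ENNReal.rpow_le_rpow ?_ (by norm_num)
      rw [enorm_mul, ← ofReal_norm (starRingEnd ℂ _), RCLike.norm_conj, ofReal_norm]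
      refine mul_le_of_le_one_left zero_le ?_
      rw [← ofReal_norm, ENNReal.ofReal_le_one]
      norm_num
    · have := congrArg (starRingEnd ℂ) (resolventKernel_equation h' x)
      rw [show 7 - μ = -2 * w by rw [hw]; ring]
      simp only [← mul_add, ← Finset.mul_sum]
      have e : (if x = 0 then (1 : ℂ) else 0) =
          Complex.I * starRingEnd ℂ (if x = 0 then Complex.I else 0) := by
        split_ifs <;> simp
      rw [e, ← this]
      simp only [map_add, map_mul, map_sum, Complex.conj_conj, map_div₀, map_one, map_ofNat]
      ring

/-- The character `ξ ↦ exp(i x · ξ)` of `ℝ^d`. -/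
def latticeChar {d : ℕ} (x : Fin d → ℤ) (ξ : Fin d → ℝ) : ℂ :=
  Complex.exp (Complex.I * ((∑ j : Fin d, (x j : ℝ) * ξ j : ℝ) : ℂ))

theorem latticeChar_add {d : ℕ} (x y : Fin d → ℤ) (ξ : Fin d → ℝ) :
    latticeChar (x + y) ξ = latticeChar x ξ * latticeChar y ξ := by
  rw [latticeChar, latticeChar, latticeChar, ← Complex.exp_add, ← mul_add, ← Complex.ofReal_add,
    ← Finset.sum_add_distrib]
  simp only [Pi.add_apply, Int.cast_add, add_mul]

@[simp] theorem latticeChar_zero {d : ℕ} (ξ : Fin d → ℝ) : latticeChar 0 ξ = 1 := by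
  simp [latticeChar]

@[simp] theorem latticeChar_zero_right {d : ℕ} (x : Fin d → ℤ) : latticeChar x 0 = 1 := by
  simp [latticeChar]

@[simp] theorem norm_latticeChar {d : ℕ} (x : Fin d → ℤ) (ξ : Fin d → ℝ) :
    ‖latticeChar x ξ‖ = 1 := by
  rw [latticeChar, mul_comm, Complex.norm_exp_ofReal_mul_I]

theorem continuous_latticeChar {d : ℕ} (x : Fin d → ℤ) : Continuous (latticeChar x) := by
  unfold latticeChar
  fun_prop

theorem latticeChar_single_add_neg {d : ℕ} (j : Fin d) (ξ : Fin d → ℝ) :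
    latticeChar (Pi.single j 1) ξ + latticeChar (-Pi.single j 1) ξ = 2 * (Real.cos (ξ j) : ℂ) := by
  have h : ∑ i, ((Pi.single j 1 : Fin d → ℤ) i : ℝ) * ξ i = ξ j := by
    rw [Finset.sum_eq_single j] <;> simp +contextual
  have h' : ∑ i, ((-Pi.single j 1 : Fin d → ℤ) i : ℝ) * ξ i = -ξ j := by
    rw [← h, ← Finset.sum_neg_distrib]
    simp
  rw [latticeChar, latticeChar, h, h', Complex.ofReal_cos, Complex.two_cos]
  push_cast
  ring_nf

theorem multKernel_eq {d : ℕ} (m : (Fin d → ℝ) → ℝ) (x : Fin d → ℤ) :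
    multKernel d m x = ((((2 * Real.pi) ^ d)⁻¹ : ℝ) : ℂ) *
      ∫ ξ in cube d, latticeChar x ξ * (m ξ : ℂ) := rfl

theorem isCompact_cube (d : ℕ) : IsCompact (cube d) := isCompact_Icc

theorem multKernel_one (d : ℕ) (x : Fin d → ℤ) :
    multKernel d (fun _ => 1) x = if x = 0 then 1 else 0 := by
  have key : ∫ ξ in cube d, latticeChar x ξ =
      ∏ j, ∫ t in Set.Icc 0 (2 * Real.pi), Complex.exp (Complex.I * ((x j * t : ℝ) : ℂ)) := by
    rw [cube, ← Set.pi_univ_Icc, volume_pi, Measure.restrict_pi_pi]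
    simp only [Pi.zero_apply]
    rw [← integral_fintype_prod_eq_prod]
    refine integral_congr_ae (Filter.Eventually.of_forall fun ξ => ?_)
    simp only [latticeChar]
    rw [← Complex.exp_sum, ← Finset.mul_sum]
    push_cast
    rfl
  have one (n : ℤ) : ∫ t in Set.Icc 0 (2 * Real.pi), Complex.exp (Complex.I * ((n * t : ℝ) : ℂ)) =
      if n = 0 then 2 * (Real.pi : ℂ) else 0 := by
    rw [integral_Icc_eq_integral_Ioc, ← intervalIntegral.integral_of_le (by positivity)]
    split_ifs with h
    · simp [h]
    · have hc : Complex.I * n ≠ 0 := by simp [h]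
      have e : (fun t : ℝ => Complex.exp (Complex.I * ((n * t : ℝ) : ℂ))) =
          fun t : ℝ => Complex.exp (Complex.I * n * t) := by
        ext t; push_cast; ring_nf
      rw [e, integral_exp_mul_complex hc]
      have := Complex.exp_int_mul_two_pi_mul_I n
      have e2 : Complex.I * n * ((2 * Real.pi : ℝ) : ℂ) = n * (2 * Real.pi * Complex.I) := by
        push_cast; ring
      rw [e2, this]
      simp
  rw [multKernel_eq]
  simp only [Complex.ofReal_one, mul_one]
  rw [key]
  simp only [one]
  split_ifs with h
  · subst h
    simp only [Pi.zero_apply, if_true, Finset.prod_const, Finset.card_univ, Fintype.card_fin]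
    push_cast
    exact inv_mul_cancel₀ (by simp [Real.pi_ne_zero])
  · obtain ⟨j, hj⟩ := Function.ne_iff.1 h
    rw [Finset.prod_eq_zero (Finset.mem_univ j) (by simpa using hj), mul_zero]

/-- `σ` is absolutely summable, with Fourier series `m`. -/
structure HasSymbol {d : ℕ} (σ : (Fin d → ℤ) → ℂ) (m : (Fin d → ℝ) → ℝ) : Prop where
  summable_norm : Summable fun y => ‖σ y‖
  hasSum : ∀ ξ, HasSum (fun y => σ y * latticeChar (-y) ξ) (m ξ : ℂ)

theorem HasSymbol.multKernel_mul {d : ℕ} {σ : (Fin d → ℤ) → ℂ} {m g : (Fin d → ℝ) → ℝ}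
    (h : HasSymbol σ m) (hg : Continuous g) (x : Fin d → ℤ) :
    multKernel d (fun ξ => m ξ * g ξ) x = ∑' y, σ y * multKernel d g (x - y) := by
  obtain ⟨B, hB⟩ := (isCompact_cube d).exists_bound_of_continuousOn hg.continuousOn
  have cont (y : Fin d → ℤ) : Continuous fun ξ => σ y * (latticeChar (x - y) ξ * (g ξ : ℂ)) :=
    continuous_const.mul ((continuous_latticeChar _).mul (Complex.continuous_ofReal.comp hg))
  have hint (y : Fin d → ℤ) :
      IntegrableOn (fun ξ => σ y * (latticeChar (x - y) ξ * (g ξ : ℂ))) (cube d) :=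
    (cont y).continuousOn.integrableOn_compact (isCompact_cube d)
  have hsum : Summable fun y => ∫ ξ in cube d, ‖σ y * (latticeChar (x - y) ξ * (g ξ : ℂ))‖ := by
    refine Summable.of_nonneg_of_le (fun y => integral_nonneg fun ξ => norm_nonneg _) (fun y => ?_)
      (h.summable_norm.mul_right (∫ ξ in cube d, ‖(g ξ : ℂ)‖))
    simp only [norm_mul, norm_latticeChar, one_mul]
    rw [integral_const_mul]
  have H := hasSum_integral_of_summable_integral_norm hint hsum
  have e : ∫ ξ in cube d, ∑' y, σ y * (latticeChar (x - y) ξ * (g ξ : ℂ)) =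
      ∫ ξ in cube d, latticeChar x ξ * ((m ξ * g ξ : ℝ) : ℂ) := by
    refine integral_congr_ae (Filter.Eventually.of_forall fun ξ => ?_)
    have := ((h.hasSum ξ).mul_left (latticeChar x ξ)).mul_right (g ξ : ℂ)
    beta_reduce
    rw [Complex.ofReal_mul, ← mul_assoc, ← this.tsum_eq]
    refine tsum_congr fun y => ?_
    rw [sub_eq_add_neg, latticeChar_add]
    ring
  rw [multKernel_eq, ← e, ← H.tsum_eq, ← tsum_mul_left]
  refine tsum_congr fun y => ?_
  rw [multKernel_eq, integral_const_mul]
  ring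

theorem HasSymbol.multKernel_eq {d : ℕ} {σ : (Fin d → ℤ) → ℂ} {m : (Fin d → ℝ) → ℝ}
    (h : HasSymbol σ m) : multKernel d m = σ := by
  ext x
  have := h.multKernel_mul (g := fun _ => 1) continuous_const x
  simp only [mul_one, multKernel_one] at this
  rw [this, tsum_eq_single x]
  · simp
  · intro y hy
    rw [if_neg (sub_ne_zero.2 hy.symm), mul_zero]

/-- The convolution kernel on `ℤ^d` of the Fourier multiplier with symbol `(∑ⱼ cos ξⱼ) ^ k`. -/
def walkKernel (d : ℕ) : ℕ → (Fin d → ℤ) → ℝ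
  | 0, x => if x = 0 then 1 else 0
  | k + 1, x => 2⁻¹ * ∑ j, (walkKernel d k (x + Pi.single j 1) + walkKernel d k (x - Pi.single j 1))

theorem walkKernel_succ (d k : ℕ) (x : Fin d → ℤ) : walkKernel d (k + 1) x =
    2⁻¹ * ∑ j, (walkKernel d k (x + Pi.single j 1) + walkKernel d k (x - Pi.single j 1)) := rfl

theorem walkKernel_nonneg (d k : ℕ) (x : Fin d → ℤ) : 0 ≤ walkKernel d k x := by
  induction k generalizing x with
  | zero => rw [walkKernel]; split_ifs <;> norm_num
  | succ k ih =>
    rw [walkKernel]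
    exact mul_nonneg (by norm_num) (Finset.sum_nonneg fun j _ => add_nonneg (ih _) (ih _))

theorem hasSum_walkKernel_mul_latticeChar (d k : ℕ) (ξ : Fin d → ℝ) :
    HasSum (fun x => (walkKernel d k x : ℂ) * latticeChar (-x) ξ)
      (((∑ j, Real.cos (ξ j)) ^ k : ℝ) : ℂ) := by
  induction k with
  | zero =>
    convert hasSum_ite_eq (0 : Fin d → ℤ) (1 : ℂ) using 1
    · ext x
      rw [walkKernel]
      split_ifs with h <;> simp [h]
    · simp
  | succ k ih =>
    have shift (v : Fin d → ℤ) : HasSum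
        (fun x => (walkKernel d k (x + v) : ℂ) * latticeChar (-x) ξ)
        (latticeChar v ξ * (((∑ j, Real.cos (ξ j)) ^ k : ℝ) : ℂ)) := by
      refine (((Equiv.addRight v).hasSum_iff.2 ih).mul_left (latticeChar v ξ)).congr_fun ?_
      intro x
      simp only [Function.comp_apply, Equiv.coe_addRight]
      rw [show -x = v + -(x + v) by abel, latticeChar_add]
      ring
    have := (hasSum_sum (s := Finset.univ) fun (j : Fin d) _ =>
      (shift (Pi.single j 1)).add (shift (-Pi.single j 1))).mul_left (2⁻¹ : ℂ)
    have e : (2⁻¹ : ℂ) * ∑ j, (latticeChar (Pi.single j 1) ξ * (((∑ j, Real.cos (ξ j)) ^ k : ℝ) : ℂ) +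
        latticeChar (-Pi.single j 1) ξ * (((∑ j, Real.cos (ξ j)) ^ k : ℝ) : ℂ)) =
        (((∑ j, Real.cos (ξ j)) ^ (k + 1) : ℝ) : ℂ) := by
      simp only [← add_mul, latticeChar_single_add_neg, ← Finset.sum_mul, ← Finset.mul_sum]
      push_cast
      ring
    rw [e] at this
    refine this.congr_fun fun x => ?_
    rw [walkKernel_succ]
    simp only [← add_mul, ← Finset.sum_mul]
    push_cast
    simp only [sub_eq_add_neg, mul_assoc]

theorem hasSum_walkKernel (d k : ℕ) : HasSum (walkKernel d k) ((d : ℝ) ^ k) := by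
  have := hasSum_walkKernel_mul_latticeChar d k 0
  simp only [latticeChar_zero_right, mul_one, Pi.zero_apply, Real.cos_zero, Finset.sum_const,
    Finset.card_univ, Fintype.card_fin, nsmul_eq_mul] at this
  exact_mod_cast this

theorem hasSymbol_tsum_walkKernel {d : ℕ} {a : ℕ → ℝ} (ha : Summable fun k => |a k| * (d : ℝ) ^ k) :
    HasSymbol (fun x : Fin d → ℤ => ∑' k, ((a k * walkKernel d k x : ℝ) : ℂ))
      (fun ξ => ∑' k, a k * (∑ j, Real.cos (ξ j)) ^ k) := by
  have hfib (k : ℕ) : HasSum (fun x => |a k| * walkKernel d k x) (|a k| * (d : ℝ) ^ k) :=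
    (hasSum_walkKernel d k).mul_left _
  have hS : Summable fun p : ℕ × (Fin d → ℤ) => |a p.1| * walkKernel d p.1 p.2 := by
    rw [summable_prod_of_nonneg fun p => mul_nonneg (abs_nonneg _) (walkKernel_nonneg d _ _)]
    refine ⟨fun k => (hfib k).summable, ha.congr fun k => ?_⟩
    exact (hfib k).tsum_eq.symm
  have hN : Summable fun p : (Fin d → ℤ) × ℕ => ‖((a p.2 * walkKernel d p.2 p.1 : ℝ) : ℂ)‖ := by
    refine ((Equiv.prodComm _ _).summable_iff.2 hS).congr fun p => ?_
    simp [abs_of_nonneg (walkKernel_nonneg d p.2 p.1)]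
  refine ⟨?_, fun ξ => ?_⟩
  · exact Summable.of_nonneg_of_le (fun _ => norm_nonneg _)
      (fun x => norm_tsum_le_tsum_norm (hN.prod_factor x)) hN.prod
  · have hC : Summable fun p : (Fin d → ℤ) × ℕ =>
        ((a p.2 * walkKernel d p.2 p.1 : ℝ) : ℂ) * latticeChar (-p.1) ξ :=
      .of_norm (hN.congr fun p => by rw [norm_mul, norm_latticeChar, mul_one])
    have h1 := hC.hasSum.prod_fiberwise fun x => (hC.prod_factor x).hasSum
    have h2 := ((Equiv.prodComm _ _).hasSum_iff.2 hC.hasSum).prod_fiberwise fun k : ℕ =>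
      (((hasSum_walkKernel_mul_latticeChar d k ξ).mul_left (a k : ℂ)).congr_fun fun x => by
        simp [mul_assoc])
    simp only [tsum_mul_right] at h1
    convert h1 using 1
    rw [← h2.tsum_eq, Complex.ofReal_tsum]
    push_cast
    rfl

theorem hasSum_choose_mul_pow {a u : ℝ} (hu : |u| < 1) :
    HasSum (fun k => Ring.choose a k * u ^ k) ((1 + u) ^ a) := by
  have h := (Real.one_add_rpow_hasFPowerSeriesOnBall_zero (a := a)).hasSum (y := u) (by
    rw [Metric.mem_eball, edist_zero_right, ← ofReal_norm, ENNReal.ofReal_lt_one]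
    exact hu)
  simpa [binomialSeries_apply, -FormalMultilinearSeries.apply_eq_prod_smul_coeff] using h

theorem summable_abs_choose_mul_pow {a r : ℝ} (h0 : 0 ≤ r) (h1 : r < 1) :
    Summable fun k => |Ring.choose a k| * r ^ k := by
  have := (binomialSeries ℝ a).summable_norm_mul_pow (r := ⟨r, h0⟩)
    (lt_of_lt_of_le (ENNReal.coe_lt_one_iff.2 h1) binomialSeries_radius_ge_one)
  refine this.congr fun k => ?_
  rw [binomialSeries, FormalMultilinearSeries.ofScalars_norm, Real.norm_eq_abs]
  rfl

theorem exists_hasSymbol_omegaKG : ∃ σ : (Fin 3 → ℤ) → ℂ, HasSymbol σ (omegaKG 3) := by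
  set a : ℕ → ℝ := fun k => Real.sqrt 7 * (Ring.choose (1 / 2 : ℝ) k * (-2 / 7) ^ k) with ha
  have hs : Summable fun k => |a k| * ((3 : ℕ) : ℝ) ^ k := by
    refine ((summable_abs_choose_mul_pow (a := 1 / 2) (r := 6 / 7) (by norm_num)
      (by norm_num)).mul_left (Real.sqrt 7)).congr fun k => ?_
    rw [ha, abs_mul, abs_mul, abs_pow, abs_of_nonneg (Real.sqrt_nonneg 7),
      show (6 / 7 : ℝ) = |-2 / 7| * (3 : ℕ) by norm_num [abs_div], mul_pow]
    ring
  have key := hasSymbol_tsum_walkKernel hs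
  refine ⟨fun x => ∑' k, ((a k * walkKernel 3 k x : ℝ) : ℂ), ?_⟩
  convert key using 1
  ext ξ
  set h := ∑ j, Real.cos (ξ j) with hh
  have hb : |h| ≤ 3 := by
    refine (Finset.abs_sum_le_sum_abs _ _).trans ?_
    refine (Finset.sum_le_card_nsmul _ _ 1 fun j _ => Real.abs_cos_le_one _).trans ?_
    simp
  have hu : |-2 / 7 * h| < 1 := by
    rw [abs_mul, show |(-2 / 7 : ℝ)| = 2 / 7 by norm_num [abs_div]]
    linarith
  have e := (hasSum_choose_mul_pow (a := 1 / 2) hu).mul_left (Real.sqrt 7)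
  rw [← Real.sqrt_eq_rpow, ← Real.sqrt_mul (by norm_num)] at e
  have e2 : omegaKG 3 ξ = Real.sqrt (7 * (1 + -2 / 7 * h)) := by
    rw [omegaKG, ← Finset.mul_sum, Finset.sum_sub_distrib, ← hh]
    congr 1
    simp
    ring
  rw [e2, ← e.tsum_eq]
  refine tsum_congr fun k => ?_
  rw [ha, mul_pow]
  ring

theorem hasSymbol_omegaKG : HasSymbol (multKernel 3 (omegaKG 3)) (omegaKG 3) := by
  obtain ⟨σ, hσ⟩ := exists_hasSymbol_omegaKG
  rwa [hσ.multKernel_eq]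

theorem continuous_omegaKG (d : ℕ) : Continuous (omegaKG d) := by
  unfold omegaKG
  fun_prop

theorem hasSymbol_laplaceKernel (d : ℕ) :
    HasSymbol (laplaceKernel d 0) fun ξ => omegaKG d ξ * omegaKG d ξ := by
  have ite_eq (v : Fin d → ℤ) (ξ : Fin d → ℝ) : HasSum
      (fun x => (if x = v then (1 : ℂ) else 0) * latticeChar (-x) ξ) (latticeChar (-v) ξ) := by
    convert hasSum_ite_eq v (latticeChar (-v) ξ) using 2 with x
    split_ifs with h <;> simp [h]
  have hs (ξ) := ((ite_eq 0 ξ).mul_left (1 + 2 * d : ℂ)).sub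
    (hasSum_sum (s := Finset.univ) fun (j : Fin d) _ =>
      (ite_eq (Pi.single j 1) ξ).add (ite_eq (-Pi.single j 1) ξ))
  have hS (ξ) : HasSum (fun x => laplaceKernel d 0 x * latticeChar (-x) ξ)
      ((omegaKG d ξ * omegaKG d ξ : ℝ) : ℂ) := by
    have e : (1 + 2 * d : ℂ) * latticeChar (-0) ξ - ∑ j : Fin d, (latticeChar (-Pi.single j 1) ξ +
        latticeChar (- -Pi.single j 1) ξ) = ((omegaKG d ξ * omegaKG d ξ : ℝ) : ℂ) := by
      rw [omegaKG, Real.mul_self_sqrt (add_nonneg zero_le_one (Finset.sum_nonneg fun j _ =>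
        mul_nonneg zero_le_two (sub_nonneg.2 (Real.cos_le_one _))))]
      simp only [neg_neg, neg_zero, latticeChar_zero]
      simp only [add_comm (latticeChar (-_) ξ), latticeChar_single_add_neg]
      push_cast
      simp only [← Finset.mul_sum, Finset.sum_sub_distrib]
      simp
      ring
    rw [← e]
    refine (hs ξ).congr_fun fun x => ?_
    simp only [laplaceKernel, sub_mul, Finset.sum_mul, add_mul, sub_zero, mul_assoc]
  refine ⟨?_, hS⟩
  have := (hS 0).summable
  simp only [latticeChar_zero_right, mul_one] at this
  exact this.norm

/-- The operator `√(1-Δ)` squares to `1-Δ`. -/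
theorem tsum_multKernel_omegaKG_mul (x : Fin 3 → ℤ) :
    ∑' y, multKernel 3 (omegaKG 3) y * multKernel 3 (omegaKG 3) (x - y) = laplaceKernel 3 0 x := by
  rw [← hasSymbol_omegaKG.multKernel_mul (continuous_omegaKG 3),
    (hasSymbol_laplaceKernel 3).multKernel_eq]

/-- **Young's convolution inequality** on a discrete group. -/
theorem ENNReal.tsum_convolution_rpow_le {G : Type*} [AddCommGroup G] [Countable G]
    (A B : G → ℝ≥0∞) {p q r : ℝ} (hp : 0 < p) (hq : 0 < q) (hpr : p ≤ r) (hqr : q ≤ r)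
    (hpqr : 1 / p + 1 / q = 1 + 1 / r) :
    ∑' x, (∑' y, A (x - y) * B y) ^ r ≤
      (∑' x, A x ^ q) ^ (r / q) * (∑' y, B y ^ p) ^ (r / p) := by
  have hr : 0 < r := hp.trans_le hpr
  have hqr' : 0 ≤ 1 / q - 1 / r := sub_nonneg.2 (one_div_le_one_div_of_le hq hqr)
  have hpr' : 0 ≤ 1 / p - 1 / r := sub_nonneg.2 (one_div_le_one_div_of_le hp hpr)
  set a := ∑' x, A x ^ q
  set b := ∑' y, B y ^ p
  have split (c : ℝ≥0∞) {s : ℝ} (hs : 0 < s) (h : 0 ≤ 1 / s - 1 / r) :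
      c = (c ^ s) ^ (1 / r) * (c ^ s) ^ (1 / s - 1 / r) := by
    rw [← ENNReal.rpow_add_of_nonneg _ _ (by positivity) h, ← ENNReal.rpow_mul]
    rw [show s * (1 / r + (1 / s - 1 / r)) = 1 by field_simp; ring, ENNReal.rpow_one]
  have shift (x : G) : ∑' y, A (x - y) ^ q = a :=
    (Equiv.subLeft x).tsum_eq fun y => A y ^ q
  have holder (x : G) : ∑' y, A (x - y) * B y ≤
      (∑' y, A (x - y) ^ q * B y ^ p) ^ (1 / r) *
        (a ^ (1 / q - 1 / r) * b ^ (1 / p - 1 / r)) := by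
    let _ : MeasurableSpace G := ⊤
    have H := ENNReal.lintegral_prod_norm_pow_le (μ := (Measure.count : Measure G)) Finset.univ
      (f := ![fun y => A (x - y) ^ q * B y ^ p, fun y => A (x - y) ^ q, fun y => B y ^ p])
      (fun i _ => (Measurable.of_discrete).aemeasurable) (p := ![1 / r, 1 / q - 1 / r, 1 / p - 1 / r])
      (by
        simp only [Fin.sum_univ_three, Matrix.cons_val]
        linarith)
      (by
        intro i _
        fin_cases i
        · exact one_div_nonneg.2 hr.le
        · exact hqr'
        · exact hpr')
    simp only [Fin.prod_univ_three, lintegral_count, Matrix.cons_val, shift] at H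
    rw [mul_assoc] at H
    refine le_trans (le_of_eq (tsum_congr fun y => ?_)) H
    rw [ENNReal.mul_rpow_of_nonneg _ _ (one_div_nonneg.2 hr.le)]
    conv_lhs => rw [split (A (x - y)) hq hqr', split (B y) hp hpr']
    ring
  have powr (c : ℝ≥0∞) {s : ℝ} (hs : 0 < s) (h : 0 ≤ 1 / s - 1 / r) :
      c * (c ^ (1 / s - 1 / r)) ^ r = c ^ (r / s) := by
    conv_lhs => rw [← ENNReal.rpow_one c, ← ENNReal.rpow_mul, ← ENNReal.rpow_mul]
    rw [← ENNReal.rpow_add_of_nonneg _ _ zero_le_one (by positivity)]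
    congr 1
    field_simp
    ring
  calc ∑' x, (∑' y, A (x - y) * B y) ^ r
      ≤ ∑' x, (∑' y, A (x - y) ^ q * B y ^ p) *
          ((a ^ (1 / q - 1 / r)) ^ r * (b ^ (1 / p - 1 / r)) ^ r) := by
        refine ENNReal.tsum_le_tsum fun x => ?_
        refine (ENNReal.rpow_le_rpow (holder x) hr.le).trans_eq ?_
        rw [ENNReal.mul_rpow_of_nonneg _ _ hr.le, ENNReal.mul_rpow_of_nonneg _ _ hr.le,
          ← ENNReal.rpow_mul, one_div_mul_cancel hr.ne', ENNReal.rpow_one]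
    _ = (a * b) * ((a ^ (1 / q - 1 / r)) ^ r * (b ^ (1 / p - 1 / r)) ^ r) := by
        rw [ENNReal.tsum_mul_right, ENNReal.tsum_comm]
        congr 1
        simp only [ENNReal.tsum_mul_right]
        have (y : G) : ∑' x, A (x - y) ^ q = a := (Equiv.subRight y).tsum_eq fun x => A x ^ q
        simp only [this, ENNReal.tsum_mul_left, b]
    _ = a ^ (r / q) * b ^ (r / p) := by
        rw [← powr a hq hqr', ← powr b hp hpr']
        ring

theorem eLpNorm_count_eq_tsum {α E : Type*} [MeasurableSpace α] [MeasurableSingletonClass α]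
    [Countable α] [NormedAddCommGroup E] (f : α → E) {p : ℝ≥0∞} (hp : p ≠ 0) (hp' : p ≠ ∞) :
    eLpNorm f p Measure.count = (∑' x, ‖f x‖ₑ ^ p.toReal) ^ (1 / p.toReal) := by
  rw [eLpNorm_eq_lintegral_rpow_enorm_toReal hp hp', lintegral_count]

theorem eLpNorm_convolution_le {G : Type*} [AddCommGroup G] [Countable G] [MeasurableSpace G]
    [MeasurableSingletonClass G] (a b : G → ℂ) {p r : ℝ≥0∞} {q : ℝ} (hp : p ≠ 0) (hr : r ≠ ∞)
    (hq : 0 < q) (hpr : p ≤ r) (hqr : q ≤ r.toReal)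
    (hpqr : 1 / p.toReal + 1 / q = 1 + 1 / r.toReal) :
    eLpNorm (fun x => ∑' y, a (x - y) * b y) r Measure.count ≤
      (∑' x, ‖a x‖ₑ ^ q) ^ (1 / q) * eLpNorm b p Measure.count := by
  have hp' : p ≠ ∞ := ne_top_of_le_ne_top hr hpr
  have hp0 : 0 < p.toReal := ENNReal.toReal_pos hp hp'
  have hpr' : p.toReal ≤ r.toReal := ENNReal.toReal_mono hr hpr
  have hr0 : 0 < r.toReal := hp0.trans_le hpr'
  rw [eLpNorm_count_eq_tsum _ (pos_of_ne_zero hp |>.trans_le hpr).ne' hr,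
    eLpNorm_count_eq_tsum _ hp hp']
  have H := ENNReal.tsum_convolution_rpow_le (fun x => ‖a x‖ₑ) (fun x => ‖b x‖ₑ) hp0 hq hpr' hqr hpqr
  refine (ENNReal.rpow_le_rpow ((ENNReal.tsum_le_tsum fun x => ENNReal.rpow_le_rpow
    (enorm_tsum_le_tsum_enorm.trans_eq ?_) hr0.le).trans H) (by positivity)).trans_eq ?_
  · simp only [enorm_mul]
  · rw [ENNReal.mul_rpow_of_nonneg _ _ (by positivity), ← ENNReal.rpow_mul, ← ENNReal.rpow_mul]
    congr 2 <;> field_simp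

theorem summable_convolution {G : Type*} [AddCommGroup G] [Countable G] {a b : G → ℂ} {p q r : ℝ}
    (hp : 0 < p) (hq : 0 < q) (hpr : p ≤ r) (hqr : q ≤ r) (hpqr : 1 / p + 1 / q = 1 + 1 / r)
    (ha : ∑' x, ‖a x‖ₑ ^ q ≠ ∞) (hb : ∑' x, ‖b x‖ₑ ^ p ≠ ∞) (x : G) :
    Summable fun y => a (x - y) * b y := by
  have hr : 0 < r := hp.trans_le hpr
  have H := ne_top_of_le_ne_top
    (ENNReal.mul_ne_top (ENNReal.rpow_ne_top_of_nonneg (by positivity) ha)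
      (ENNReal.rpow_ne_top_of_nonneg (by positivity) hb))
    (ENNReal.tsum_convolution_rpow_le (fun x => ‖a x‖ₑ) (fun x => ‖b x‖ₑ) hp hq hpr hqr hpqr)
  have H' := ENNReal.ne_top_of_tsum_ne_top H x
  rw [Ne, ENNReal.rpow_eq_top_iff_of_pos hr] at H'
  refine Summable.of_enorm ?_
  simpa only [enorm_mul] using H'

theorem tsum_convolution_assoc {G : Type*} [AddCommGroup G] {a b ψ : G → ℂ} {M : ℝ≥0∞}
    (ha : ∑' x, ‖a x‖ₑ ≠ ∞) (hb : ∑' x, ‖b x‖ₑ ≠ ∞) (hM : M ≠ ∞) (hψ : ∀ x, ‖ψ x‖ₑ ≤ M) (x : G) :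
    ∑' y, a (x - y) * ∑' z, b (y - z) * ψ z = ∑' z, (∑' y, a y * b (x - z - y)) * ψ z := by
  have hs : Summable (Function.uncurry fun y z => a (x - y) * (b (y - z) * ψ z)) := by
    refine Summable.of_enorm ?_
    rw [ENNReal.tsum_prod']
    refine ne_top_of_le_ne_top (b := (∑' x, ‖a x‖ₑ) * ((∑' x, ‖b x‖ₑ) * M))
      (ENNReal.mul_ne_top ha (ENNReal.mul_ne_top hb hM)) ?_
    rw [← (Equiv.subLeft x).tsum_eq, ← ENNReal.tsum_mul_right]
    refine ENNReal.tsum_le_tsum fun y => ?_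
    simp only [Function.uncurry_apply_pair, enorm_mul, Equiv.subLeft_apply, sub_sub_cancel]
    rw [ENNReal.tsum_mul_left, ← (Equiv.subLeft (x - y)).tsum_eq fun z => ‖b z‖ₑ,
      ← ENNReal.tsum_mul_right]
    simp only [Equiv.subLeft_apply]
    gcongr
    exact hψ _
  simp only [← tsum_mul_left, ← tsum_mul_right]
  rw [← hs.tsum_comm]
  refine tsum_congr fun z => ?_
  rw [← (Equiv.subLeft x).tsum_eq]
  refine tsum_congr fun y => ?_
  simp only [Equiv.subLeft_apply]
  rw [sub_sub_cancel, sub_right_comm]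
  ring

theorem tsum_laplaceKernel_mul {d : ℕ} (ψ : (Fin d → ℤ) → ℂ) (x : Fin d → ℤ) :
    ∑' z, laplaceKernel d 0 (x - z) * ψ z =
      (1 + 2 * d) * ψ x - ∑ j, (ψ (x + Pi.single j 1) + ψ (x - Pi.single j 1)) := by
  have ite_eq (v : Fin d → ℤ) : HasSum
      (fun z => (if x - z = v then (1 : ℂ) else 0) * ψ z) (ψ (x - v)) := by
    convert hasSum_ite_eq (x - v) (ψ (x - v)) using 2 with z
    have : x - z = v ↔ z = x - v := ⟨fun h => by rw [← h]; abel, fun h => by rw [h]; abel⟩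
    simp only [this]
    split_ifs with h <;> simp [h]
  have hs := ((ite_eq 0).mul_left (1 + 2 * d : ℂ)).sub
    (hasSum_sum (s := Finset.univ) fun (j : Fin d) _ =>
      (ite_eq (Pi.single j 1)).add (ite_eq (-Pi.single j 1)))
  simp only [sub_zero, sub_neg_eq_add] at hs
  simp only [add_comm (ψ (x + _))]
  rw [← hs.tsum_eq]
  refine tsum_congr fun z => ?_
  simp only [laplaceKernel, sub_mul, Finset.sum_mul, add_mul, sub_zero, mul_assoc]

theorem tsum_fundamentalSolution_mul {d : ℕ} {c : ℂ} {K ψ : (Fin d → ℤ) → ℂ}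
    (hK : ∀ x, c * K x - ∑ j, (K (x + Pi.single j 1) + K (x - Pi.single j 1)) =
      if x = 0 then 1 else 0)
    (hs : ∀ x, Summable fun y => K (x - y) * ψ y) (x : Fin d → ℤ) :
    ∑' y, K (x - y) * (c * ψ y - ∑ j, (ψ (y + Pi.single j 1) + ψ (y - Pi.single j 1))) = ψ x := by
  have shift (v : Fin d → ℤ) : HasSum (fun y => K (x - y) * ψ (y + v))
      (∑' y, K (x + v - y) * ψ y) := by
    refine ((Equiv.addRight v).hasSum_iff.2 (hs (x + v)).hasSum).congr_fun fun y => ?_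
    simp only [Function.comp_apply, Equiv.coe_addRight]
    rw [show x + v - (y + v) = x - y by abel]
  have h1 := (((hs x).hasSum).mul_left c).sub (hasSum_sum (s := Finset.univ) fun (j : Fin d) _ =>
      (shift (Pi.single j 1)).add (shift (-Pi.single j 1)))
  have h2 := (((hs x).hasSum).mul_left c).sub (hasSum_sum (s := Finset.univ) fun (j : Fin d) _ =>
      ((hs (x + Pi.single j 1)).hasSum).add ((hs (x + -Pi.single j 1)).hasSum))
  have h3 : HasSum (fun y => (if y = x then (1 : ℂ) else 0) * ψ y) (ψ x) := by
    convert hasSum_ite_eq x (ψ x) using 2 with y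
    split_ifs with h <;> simp [h]
  have e : ∀ y, c * (K (x - y) * ψ y) - ∑ j, (K (x + Pi.single j 1 - y) * ψ y +
      K (x + -Pi.single j 1 - y) * ψ y) = (if y = x then (1 : ℂ) else 0) * ψ y := by
    intro y
    have := hK (x - y)
    simp only [sub_eq_zero, eq_comm (a := x)] at this
    rw [← this, sub_mul, Finset.sum_mul, mul_assoc]
    congr 1
    refine Finset.sum_congr rfl fun j _ => ?_
    rw [add_mul]
    congr 3 <;> abel
  simp only [e] at h2
  rw [h2.unique h3] at h1
  rw [← h1.tsum_eq]
  refine tsum_congr fun y => ?_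
  simp only [mul_sub, Finset.mul_sum, mul_add, sub_eq_add_neg (G := Fin d → ℤ) y]
  ring

theorem tsum_enorm_multKernel_omegaKG_ne_top : ∑' x, ‖multKernel 3 (omegaKG 3) x‖ₑ ≠ ∞ :=
  tsum_enorm_ne_top_iff_summable_norm.2 hasSymbol_omegaKG.summable_norm

theorem eLpNorm_sqrtOneSubLap_le (ψ : (Fin 3 → ℤ) → ℂ) {p : ℝ≥0∞} (hp : 1 ≤ p) (hp' : p ≠ ∞) :
    eLpNorm (sqrtOneSubLap 3 ψ) p Measure.count ≤
      (∑' x, ‖multKernel 3 (omegaKG 3) x‖ₑ) * eLpNorm ψ p Measure.count := by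
  have h := eLpNorm_convolution_le (multKernel 3 (omegaKG 3)) ψ (p := p) (r := p) (q := 1)
    (by positivity) hp' one_pos le_rfl (by simpa using ENNReal.toReal_mono hp' hp) (by ring)
  simp only [ENNReal.rpow_one, div_one] at h
  exact h

theorem tsum_rpow_ne_top_of_eLpNorm_ne_top {α : Type*} [MeasurableSpace α]
    [MeasurableSingletonClass α] [Countable α] {f : α → ℂ} {p : ℝ≥0∞} (hp : p ≠ 0) (hp' : p ≠ ∞)
    (h : eLpNorm f p Measure.count ≠ ∞) : ∑' x, ‖f x‖ₑ ^ p.toReal ≠ ∞ := by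
  rwa [eLpNorm_count_eq_tsum _ hp hp', Ne,
    ENNReal.rpow_eq_top_iff_of_pos (one_div_pos.2 (ENNReal.toReal_pos hp hp'))] at h

theorem enorm_le_eLpNorm_count {α : Type*} [MeasurableSpace α] [MeasurableSingletonClass α]
    [Countable α] (f : α → ℂ) {p : ℝ≥0∞} (hp : p ≠ 0) (hp' : p ≠ ∞) (x : α) :
    ‖f x‖ₑ ≤ eLpNorm f p Measure.count := by
  have hp0 := ENNReal.toReal_pos hp hp'
  rw [eLpNorm_count_eq_tsum _ hp hp', one_div, ENNReal.le_rpow_inv_iff hp0]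
  exact ENNReal.le_tsum x

theorem eLpNorm_ne_top_of_memℓp {α : Type*} [MeasurableSpace α] [MeasurableSingletonClass α]
    [Countable α] {f : α → ℂ} {p : ℝ≥0∞} (hp : p ≠ 0) (hp' : p ≠ ∞) (hf : Memℓp f p) :
    eLpNorm f p Measure.count ≠ ∞ := by
  have hp0 := ENNReal.toReal_pos hp hp'
  rw [eLpNorm_count_eq_tsum _ hp hp']
  refine ENNReal.rpow_ne_top_of_nonneg (by positivity) ?_
  convert ((memℓp_gen_iff hp0).1 hf).tsum_ofReal_ne_top using 3 with x
  rw [← ofReal_norm, ENNReal.ofReal_rpow_of_nonneg (norm_nonneg _) hp0.le]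

theorem sqrtOneSubLap_sqrtOneSubLap {ψ : (Fin 3 → ℤ) → ℂ} {p : ℝ≥0∞} (hp : p ≠ 0) (hp' : p ≠ ∞)
    (hψ : eLpNorm ψ p Measure.count ≠ ∞) (x : Fin 3 → ℤ) :
    sqrtOneSubLap 3 (sqrtOneSubLap 3 ψ) x =
      7 * ψ x - ∑ j, (ψ (x + Pi.single j 1) + ψ (x - Pi.single j 1)) := by
  have h := tsum_convolution_assoc tsum_enorm_multKernel_omegaKG_ne_top
    tsum_enorm_multKernel_omegaKG_ne_top hψ (enorm_le_eLpNorm_count ψ hp hp') x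
  simp only [tsum_multKernel_omegaKG_mul, tsum_laplaceKernel_mul] at h
  rw [show (7 : ℂ) = 1 + 2 * (3 : ℕ) by norm_num, ← h]
  rfl

theorem sqrtOneSubLap_sub_smul {f g : (Fin 3 → ℤ) → ℂ} {p : ℝ≥0∞} (hp : 1 ≤ p) (hp' : p ≠ ∞)
    (hf : eLpNorm f p Measure.count ≠ ∞) (hg : eLpNorm g p Measure.count ≠ ∞) (c : ℂ)
    (x : Fin 3 → ℤ) : sqrtOneSubLap 3 (fun y => f y - c * g y) x =
      sqrtOneSubLap 3 f x - c * sqrtOneSubLap 3 g x := by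
  have hp0 : p ≠ 0 := (zero_lt_one.trans_le hp).ne'
  have hp1 : 1 ≤ p.toReal := by simpa using ENNReal.toReal_mono hp' hp
  have hs {f : (Fin 3 → ℤ) → ℂ} (hf : eLpNorm f p Measure.count ≠ ∞) :
      Summable fun y => multKernel 3 (omegaKG 3) (x - y) * f y :=
    summable_convolution (zero_lt_one.trans_le hp1) one_pos le_rfl hp1 (by ring)
      (by simpa using tsum_enorm_multKernel_omegaKG_ne_top)
      (tsum_rpow_ne_top_of_eLpNorm_ne_top hp0 hp' hf) x
  rw [sqrtOneSubLap, sqrtOneSubLap, sqrtOneSubLap,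
    ← ((hs hf).hasSum.sub ((hs hg).hasSum.mul_left c)).tsum_eq]
  exact tsum_congr fun y => by ring

theorem eLpNorm_fourteen_le (ψ : (Fin 3 → ℤ) → ℂ) :
    eLpNorm ψ 14 Measure.count ≤ eLpNorm ψ (14 / 13) Measure.count := by
  have h := eLpNorm_convolution_le (fun x => if x = 0 then 1 else 0) ψ (p := 14 / 13) (r := 14)
    (q := 7) (by simp) (by simp) (by norm_num) (ENNReal.div_le_of_le_mul (by norm_num)) (by norm_num)
    (by norm_num)
  have e1 (x : Fin 3 → ℤ) : ∑' y, (if x - y = 0 then (1 : ℂ) else 0) * ψ y = ψ x := by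
    rw [tsum_eq_single x fun y hy => by rw [if_neg (sub_ne_zero.2 hy.symm), zero_mul]]
    simp
  have e2 : ∑' x : Fin 3 → ℤ, ‖if x = 0 then (1 : ℂ) else 0‖ₑ ^ (7 : ℝ) = 1 := by
    rw [tsum_eq_single 0 fun y hy => by simp [hy]]
    simp
  simpa only [e1, e2, ENNReal.one_rpow, one_mul] using h

theorem eLpNorm_le_of_norm_ge {lam : ℂ} {ψ : (Fin 3 → ℤ) → ℂ} {p : ℝ≥0∞} (hp : 1 ≤ p) (hp' : p ≠ ∞)
    (hψ : eLpNorm ψ p Measure.count ≠ ∞)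
    (hlam : (∑' x, ‖multKernel 3 (omegaKG 3) x‖ₑ) + 1 ≤ ‖lam‖ₑ) :
    eLpNorm ψ p Measure.count ≤
      eLpNorm (fun x => sqrtOneSubLap 3 ψ x - lam * ψ x) p Measure.count := by
  have h : ‖lam‖ₑ * eLpNorm ψ p Measure.count ≤
      (∑' x, ‖multKernel 3 (omegaKG 3) x‖ₑ) * eLpNorm ψ p Measure.count +
        eLpNorm (fun x => sqrtOneSubLap 3 ψ x - lam * ψ x) p Measure.count := by
    rw [← eLpNorm_const_smul]
    refine le_trans (le_of_eq ?_) ((eLpNorm_sub_le (f := sqrtOneSubLap 3 ψ)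
      (g := fun x => sqrtOneSubLap 3 ψ x - lam * ψ x) .of_discrete .of_discrete hp).trans
        (add_le_add_left (eLpNorm_sqrtOneSubLap_le ψ hp hp') _))
    congr 1
    ext x
    simp
  have h2 := (mul_le_mul_left hlam _).trans h
  rw [add_mul, one_mul] at h2
  exact (ENNReal.add_le_add_iff_left
    (ENNReal.mul_ne_top tsum_enorm_multKernel_omegaKG_ne_top hψ)).1 h2

theorem eLpNorm_le_fundamentalSolution {lam : ℂ} {ψ : (Fin 3 → ℤ) → ℂ}
    (hψ : eLpNorm ψ (14 / 13) Measure.count ≠ ∞) :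
    eLpNorm ψ 14 Measure.count ≤ ((∑' n : ℤ, besselMoment n ^ (7 / 3 : ℝ)) ^ 3) ^ (1 / 7 : ℝ) *
      (((∑' x, ‖multKernel 3 (omegaKG 3) x‖ₑ) + ‖lam‖ₑ) *
        eLpNorm (fun x => sqrtOneSubLap 3 ψ x - lam * ψ x) (14 / 13) Measure.count) := by
  have hp : (1 : ℝ≥0∞) ≤ 14 / 13 := by
    rw [ENNReal.le_div_iff_mul_le (by simp) (by simp)]; norm_num
  have hp' : (14 / 13 : ℝ≥0∞) ≠ ∞ := ENNReal.div_ne_top (by simp) (by simp)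
  have hp0 : (14 / 13 : ℝ≥0∞) ≠ 0 := by simp
  set f := fun x => sqrtOneSubLap 3 ψ x - lam * ψ x with hf
  obtain ⟨K, hK7, hK⟩ := exists_fundamentalSolution (lam ^ 2)
  have hKtop := ne_top_of_le_ne_top (ENNReal.pow_ne_top tsum_besselMoment_rpow_lt_top.ne) hK7
  have hsψ : eLpNorm (sqrtOneSubLap 3 ψ) (14 / 13) Measure.count ≠ ∞ := ne_top_of_le_ne_top
    (ENNReal.mul_ne_top tsum_enorm_multKernel_omegaKG_ne_top hψ) (eLpNorm_sqrtOneSubLap_le ψ hp hp')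
  have hg (x) : sqrtOneSubLap 3 f x + lam * f x =
      (7 - lam ^ 2) * ψ x - ∑ j, (ψ (x + Pi.single j 1) + ψ (x - Pi.single j 1)) := by
    rw [hf, sqrtOneSubLap_sub_smul hp hp' hsψ hψ, sqrtOneSubLap_sqrtOneSubLap hp0 hp' hψ]
    ring
  have hrep : ψ = fun x => ∑' y, K (x - y) * (sqrtOneSubLap 3 f y + lam * f y) := by
    ext x
    simp only [hg]
    refine (tsum_fundamentalSolution_mul hK (fun x => ?_) x).symm
    exact summable_convolution (p := (14 / 13 : ℝ≥0∞).toReal) (q := 7) (r := 14) (by norm_num)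
      (by norm_num) (by norm_num) (by norm_num) (by norm_num) hKtop
      (tsum_rpow_ne_top_of_eLpNorm_ne_top hp0 hp' hψ) x
  conv_lhs => rw [hrep]
  refine (eLpNorm_convolution_le K _ (p := 14 / 13) (q := 7) hp0 (by simp) (by norm_num)
    (ENNReal.div_le_of_le_mul (by norm_num)) (by norm_num) (by norm_num)).trans ?_
  gcongr
  rw [add_mul, ← eLpNorm_const_smul]
  exact (eLpNorm_add_le (f := sqrtOneSubLap 3 f) (g := lam • f) .of_discrete .of_discrete hp).trans
    (add_le_add_left (eLpNorm_sqrtOneSubLap_le f hp hp') _)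

/-- Uniform resolvent estimate for `√(1−Δ)` on `ℤ³`:
`‖ψ‖_{ℓ^{14}} ≤ C ‖(√(1−Δ) − λ)ψ‖_{ℓ^{14/13}}` uniformly in `λ ∈ ℂ`
(here `14 = 2σ/(σ−1)` and `14/13 = 2σ/(σ+1)` with `σ = 7/6`). -/
theorem resolvent_estimate_d3 :
    ∃ C > (0:ℝ), ∀ (lam : ℂ) (ψ : (Fin 3 → ℤ) → ℂ), Memℓp ψ (14/13) →
      eLpNorm ψ 14 Measure.count ≤
        ENNReal.ofReal C *
          eLpNorm (fun x => sqrtOneSubLap 3 ψ x - lam * ψ x) (14/13) Measure.count := by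
  have hp : (1 : ℝ≥0∞) ≤ 14 / 13 := by
    rw [ENNReal.le_div_iff_mul_le (by simp) (by simp)]; norm_num
  have hp' : (14 / 13 : ℝ≥0∞) ≠ ∞ := ENNReal.div_ne_top (by simp) (by simp)
  set S := ∑' x, ‖multKernel 3 (omegaKG 3) x‖ₑ
  set M : ℝ≥0∞ := ((∑' n : ℤ, besselMoment n ^ (7 / 3 : ℝ)) ^ 3) ^ (1 / 7 : ℝ)
  have hS : S ≠ ∞ := tsum_enorm_multKernel_omegaKG_ne_top
  have hC : M * (S + (S + 1)) + 1 ≠ ∞ := by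
    have hM : M ≠ ∞ := ENNReal.rpow_ne_top_of_nonneg (by norm_num)
      (ENNReal.pow_ne_top tsum_besselMoment_rpow_lt_top.ne)
    finiteness
  refine ⟨(M * (S + (S + 1)) + 1).toReal, ENNReal.toReal_pos (by simp) hC, fun lam ψ hψ => ?_⟩
  rw [ENNReal.ofReal_toReal hC]
  have hψ' := eLpNorm_ne_top_of_memℓp (by simp) hp' hψ
  rcases le_total (S + 1) ‖lam‖ₑ with h | h
  · refine (eLpNorm_fourteen_le ψ).trans ((eLpNorm_le_of_norm_ge hp hp' hψ' h).trans ?_)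
    exact le_mul_of_one_le_left zero_le le_add_self
  · refine (eLpNorm_le_fundamentalSolution (lam := lam) hψ').trans ?_
    rw [← mul_assoc]
    refine mul_le_mul_left ((mul_le_mul_right ?_ M).trans le_self_add) _
    gcongr
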